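/- arXiv:2307.13937 — 7 statements merged into one kernel-verified Lean document; each statement's English description precedes it below -/
import Mathlib

section
/- There is a constant c > 0 such that for all sufficiently large n there exists an instance of the Generalized Makespan Problem with n jobs, m = ⌊√(log n)⌋ machines, processing times p_{ij} ∈ ℝ_{≥0} ∪ {∞}, and a symmetric monotone norm ψ on ℝ^n (the same on every machine) with the following two properties. (1) The configuration LP with threshold T = 2 is feasible: there exist values x_{i,C} ∈ [0,1] for machines i and job sets C such that Σ_C x_{i,C} ≤ 1 for every machine i, Σ_{i, C ∋ j} x_{i,C} = 1 for every job j, and x_{i,C} = 0 whenever ψ(p_i[C]) > 2, where p_i[C] denotes the vector whose j-th entry is p_{ij} for j ∈ C and 0 otherwise. (2) For every assignment ρ of jobs to machines with ρ(j) = i only if p_{ij} < ∞, there is some machine i with ψ(p_i[ρ^{-1}(i)]) ≥ c·√(log n). Consequently, the configuration LP for GMP has integrality gap Ω(√(log n)). -/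
open Finset
open scoped Classical ENNReal

/-- The sum of the `q` largest absolute values of the entries of `u`. -/
noncomputable def topSum {n : ℕ} (q : ℕ) (u : Fin n → ℝ) : ℝ :=
  (univ.filter fun A : Finset (Fin n) => A.card ≤ q).sup' ⟨∅, by simp⟩ fun A => ∑ j ∈ A, |u j|

section TopSum

variable {n q : ℕ} {u v : Fin n → ℝ}

theorem topSum_le {b : ℝ} (h : ∀ A : Finset (Fin n), A.card ≤ q → ∑ j ∈ A, |u j| ≤ b) :
    topSum q u ≤ b :=
  Finset.sup'_le _ _ fun A hA => h A (mem_filter.1 hA).2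

theorem sum_abs_le_topSum (u : Fin n → ℝ) {A : Finset (Fin n)} (hA : A.card ≤ q) :
    ∑ j ∈ A, |u j| ≤ topSum q u :=
  Finset.le_sup' (fun A : Finset (Fin n) => ∑ j ∈ A, |u j|) (mem_filter.2 ⟨mem_univ A, hA⟩)

theorem topSum_nonneg (q : ℕ) (u : Fin n → ℝ) : 0 ≤ topSum q u := by
  simpa using sum_abs_le_topSum (q := q) u (A := ∅) (by simp)

theorem abs_le_topSum (hq : 1 ≤ q) (u : Fin n → ℝ) (j : Fin n) : |u j| ≤ topSum q u := by
  simpa using sum_abs_le_topSum (q := q) u (A := {j}) (by simpa using hq)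

theorem topSum_smul_le (a : ℝ) (u : Fin n → ℝ) : topSum q (a • u) ≤ |a| * topSum q u := by
  refine topSum_le fun A hA => ?_
  simp only [Pi.smul_apply, smul_eq_mul, abs_mul, ← mul_sum]
  exact mul_le_mul_of_nonneg_left (sum_abs_le_topSum u hA) (abs_nonneg a)

theorem topSum_smul (a : ℝ) (u : Fin n → ℝ) : topSum q (a • u) = |a| * topSum q u := by
  refine le_antisymm (topSum_smul_le a u) ?_
  rcases eq_or_ne a 0 with rfl | ha
  · simpa using topSum_nonneg q (0 : Fin n → ℝ)
  · have h := topSum_smul_le (q := q) a⁻¹ (a • u)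
    rw [inv_smul_smul₀ ha, abs_inv] at h
    rwa [← le_inv_mul_iff₀ (abs_pos.2 ha)]

theorem topSum_add_le (u v : Fin n → ℝ) : topSum q (u + v) ≤ topSum q u + topSum q v := by
  refine topSum_le fun A hA => ?_
  calc ∑ j ∈ A, |(u + v) j| ≤ ∑ j ∈ A, (|u j| + |v j|) := sum_le_sum fun j _ => abs_add_le _ _
    _ = ∑ j ∈ A, |u j| + ∑ j ∈ A, |v j| := sum_add_distrib
    _ ≤ _ := add_le_add (sum_abs_le_topSum u hA) (sum_abs_le_topSum v hA)

theorem topSum_comp_perm_le (e : Equiv.Perm (Fin n)) (u : Fin n → ℝ) :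
    topSum q (u ∘ e) ≤ topSum q u := by
  refine topSum_le fun A hA => ?_
  have h := sum_abs_le_topSum u (A := A.map e.toEmbedding) (q := q) (by simpa using hA)
  simpa using h

theorem topSum_comp_perm (e : Equiv.Perm (Fin n)) (u : Fin n → ℝ) :
    topSum q (u ∘ e) = topSum q u := by
  refine le_antisymm (topSum_comp_perm_le e u) ?_
  have h := topSum_comp_perm_le (q := q) e.symm (u ∘ e)
  rwa [Function.comp_assoc, Equiv.self_comp_symm, Function.comp_id] at h

theorem topSum_mono (hu : ∀ j, 0 ≤ u j) (huv : ∀ j, u j ≤ v j) : topSum q u ≤ topSum q v :=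
  topSum_le fun _ hA => (sum_le_sum fun j _ => abs_le_abs_of_nonneg (hu j) (huv j)).trans
    (sum_abs_le_topSum v hA)

theorem topSum_le_mul_of_abs_le {a : ℝ} (ha : 0 ≤ a) (hu : ∀ j, |u j| ≤ a) :
    topSum q u ≤ q * a := by
  refine topSum_le fun A hA => ?_
  calc ∑ j ∈ A, |u j| ≤ A.card • a := sum_le_card_nsmul _ _ _ fun j _ => hu j
    _ ≤ q * a := by
      rw [nsmul_eq_mul]
      gcongr

theorem topSum_le_card_mul_of_support {a : ℝ} {D : Finset (Fin n)} (hu : ∀ j, |u j| ≤ a)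
    (hD : ∀ j ∉ D, u j = 0) : topSum q u ≤ D.card * a := by
  refine topSum_le fun A _ => ?_
  calc ∑ j ∈ A, |u j| ≤ ∑ j ∈ D, |u j| := by
        rw [← sum_filter_of_ne (s := A) (p := (· ∈ D))]
        · exact sum_le_sum_of_subset_of_nonneg (fun j hj => (mem_filter.1 hj).2)
            fun _ _ _ => abs_nonneg _
        · intro j _ hj
          by_contra h
          exact hj (by rw [hD j h, abs_zero])
    _ ≤ D.card • a := sum_le_card_nsmul _ _ _ fun j _ => hu j
    _ = D.card * a := nsmul_eq_mul _ _

theorem mul_le_topSum {a : ℝ} {D : Finset (Fin n)} (hq : q ≤ D.card) (hu : ∀ j ∈ D, a ≤ |u j|) :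
    q * a ≤ topSum q u := by
  obtain ⟨A, hAD, hA⟩ := exists_subset_card_eq hq
  calc (q : ℝ) * a = A.card • a := by rw [hA, nsmul_eq_mul]
    _ ≤ ∑ j ∈ A, |u j| := card_nsmul_le_sum _ _ _ fun j hj => hu j (hAD hj)
    _ ≤ _ := sum_abs_le_topSum u hA.le

end TopSum

/-- A combination of top-`B ^ l` norms whose fundamental function grows by a factor of about two
between consecutive powers of `B`. -/
noncomputable def multiscaleNorm {n : ℕ} (s B : ℕ) (u : Fin n → ℝ) : ℝ :=
  1 / 2 * ∑ l : Fin s, (2 / B : ℝ) ^ (l : ℕ) * topSum (B ^ (l : ℕ)) u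

section MultiscaleNorm

variable {n s B : ℕ} {u v : Fin n → ℝ}

theorem multiscaleNorm_nonneg (s B : ℕ) (u : Fin n → ℝ) : 0 ≤ multiscaleNorm s B u :=
  mul_nonneg (by norm_num) (sum_nonneg fun _ _ => mul_nonneg (by positivity) (topSum_nonneg _ _))

theorem multiscaleNorm_smul (a : ℝ) (u : Fin n → ℝ) :
    multiscaleNorm s B (a • u) = |a| * multiscaleNorm s B u := by
  simp only [multiscaleNorm, topSum_smul, mul_sum]
  exact sum_congr rfl fun _ _ => by ring

theorem multiscaleNorm_eq_zero_iff (hs : 0 < s) : multiscaleNorm s B u = 0 ↔ u = 0 := by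
  constructor
  · intro h
    have h0 : ∑ l : Fin s, (2 / B : ℝ) ^ (l : ℕ) * topSum (B ^ (l : ℕ)) u = 0 := by
      simpa [multiscaleNorm] using h
    have h1 := (sum_eq_zero_iff_of_nonneg fun (l : Fin s) _ =>
      mul_nonneg (pow_nonneg (by positivity) _) (topSum_nonneg _ _)).1 h0 ⟨0, hs⟩ (mem_univ _)
    simp only [pow_zero, one_mul] at h1
    funext j
    exact abs_nonpos_iff.1 ((abs_le_topSum le_rfl u j).trans h1.le)
  · rintro rfl
    simpa using multiscaleNorm_smul (s := s) (B := B) 0 (0 : Fin n → ℝ)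

theorem multiscaleNorm_add_le (u v : Fin n → ℝ) :
    multiscaleNorm s B (u + v) ≤ multiscaleNorm s B u + multiscaleNorm s B v := by
  simp only [multiscaleNorm]
  rw [← mul_add, ← sum_add_distrib]
  refine mul_le_mul_of_nonneg_left (sum_le_sum fun l _ => ?_) (by norm_num)
  rw [← mul_add]
  exact mul_le_mul_of_nonneg_left (topSum_add_le u v) (by positivity)

theorem multiscaleNorm_comp_perm (e : Equiv.Perm (Fin n)) (u : Fin n → ℝ) :
    multiscaleNorm s B (u ∘ e) = multiscaleNorm s B u := by
  simp only [multiscaleNorm, topSum_comp_perm]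

theorem multiscaleNorm_mono (hu : ∀ j, 0 ≤ u j) (huv : ∀ j, u j ≤ v j) :
    multiscaleNorm s B u ≤ multiscaleNorm s B v :=
  mul_le_mul_of_nonneg_left (sum_le_sum fun _ _ =>
    mul_le_mul_of_nonneg_left (topSum_mono hu huv) (by positivity)) (by norm_num)

theorem sum_min_two_pow_le (k s : ℕ) :
    ∑ l ∈ range s, min ((2 : ℝ) ^ l / 2 ^ k) (2 ^ k / 2 ^ l) ≤
      if s ≤ k then (2 : ℝ) ^ s / 2 ^ k else 3 - 2 * 2 ^ k / 2 ^ s := by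
  induction s with
  | zero => simp
  | succ s ih =>
    rw [sum_range_succ]
    have h1 := min_le_left ((2 : ℝ) ^ s / 2 ^ k) (2 ^ k / 2 ^ s)
    have h2 := min_le_right ((2 : ℝ) ^ s / 2 ^ k) (2 ^ k / 2 ^ s)
    have e1 : (2 : ℝ) ^ (s + 1) / 2 ^ k = 2 * (2 ^ s / 2 ^ k) := by ring
    have e2 : (2 : ℝ) * 2 ^ k / 2 ^ (s + 1) = 2 ^ k / 2 ^ s := by
      field_simp
      ring
    have e3 : (2 : ℝ) * 2 ^ k / 2 ^ s = 2 * (2 ^ k / 2 ^ s) := by ring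
    rw [e1, e2]
    rw [e3] at ih
    rcases lt_trichotomy s k with h | rfl | h
    · rw [if_pos h.le] at ih
      rw [if_pos (show s + 1 ≤ k from h)]
      linarith
    · rw [if_pos le_rfl] at ih
      rw [if_neg (by omega)]
      have : (2 : ℝ) ^ s / 2 ^ s = 1 := div_self (by positivity)
      linarith
    · rw [if_neg (by omega)] at ih
      rw [if_neg (by omega)]
      linarith

/-- A vector with at most `R * B ^ k` nonzero entries, all at most `2⁻ᵏ`, is short. -/
theorem multiscaleNorm_le_two {R k : ℕ} {D : Finset (Fin n)} (hR : 1 ≤ R) (hB : 4 * R ≤ B)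
    (hu : ∀ j, |u j| ≤ (1 / 2 : ℝ) ^ k) (hD : ∀ j ∉ D, u j = 0) (hcard : D.card ≤ R * B ^ k) :
    multiscaleNorm s B u ≤ 2 := by
  have hB0 : (0 : ℝ) < B := by
    have : 0 < B := by omega
    exact_mod_cast this
  have hBR : (4 : ℝ) * R ≤ B := by exact_mod_cast hB
  have hR0 : (1 : ℝ) ≤ R := by exact_mod_cast hR
  have key : ∀ l : ℕ, (2 / B : ℝ) ^ l * topSum (B ^ l) u ≤
      min ((2 : ℝ) ^ l / 2 ^ k) (2 ^ k / 2 ^ l) := by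
    intro l
    have h1 : (2 / B : ℝ) ^ l * topSum (B ^ l) u ≤ (2 : ℝ) ^ l / 2 ^ k := by
      calc (2 / B : ℝ) ^ l * topSum (B ^ l) u
          ≤ (2 / B : ℝ) ^ l * ((B ^ l : ℕ) * (1 / 2 : ℝ) ^ k) :=
            mul_le_mul_of_nonneg_left (topSum_le_mul_of_abs_le (by positivity) hu) (by positivity)
        _ = (2 : ℝ) ^ l / 2 ^ k := by
          push_cast
          rw [div_pow, div_pow, one_pow]
          field_simp
    refine le_min h1 ?_
    rcases le_or_gt l k with hlk | hlk
    · refine h1.trans ?_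
      have h2 : (2 : ℝ) ^ l ≤ 2 ^ k := pow_le_pow_right₀ (by norm_num) hlk
      exact (div_le_one_of_le₀ h2 (by positivity)).trans
        ((one_le_div (by positivity)).2 h2)
    · obtain ⟨d, rfl⟩ := Nat.exists_eq_add_of_lt hlk
      have hc : (D.card : ℝ) ≤ R * (B : ℝ) ^ k := by exact_mod_cast hcard
      have hd : (R : ℝ) * 4 ^ (d + 1) ≤ (B : ℝ) ^ (d + 1) := by
        calc (R : ℝ) * 4 ^ (d + 1) ≤ (R : ℝ) ^ (d + 1) * 4 ^ (d + 1) := by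
              gcongr
              exact le_self_pow₀ hR0 (by omega)
          _ = (4 * R : ℝ) ^ (d + 1) := by rw [mul_pow, mul_comm]
          _ ≤ _ := by gcongr
      calc (2 / B : ℝ) ^ (k + d + 1) * topSum (B ^ (k + d + 1)) u
          ≤ (2 / B : ℝ) ^ (k + d + 1) * ((R * (B : ℝ) ^ k) * (1 / 2 : ℝ) ^ k) := by
            refine mul_le_mul_of_nonneg_left ?_ (by positivity)
            refine (topSum_le_card_mul_of_support hu hD).trans ?_
            gcongr
        _ = R * 2 ^ (d + 1) / (B : ℝ) ^ (d + 1) := by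
          rw [add_assoc, div_pow, div_pow, one_pow, pow_add, pow_add (B : ℝ)]
          field_simp
        _ ≤ 1 / 2 ^ (d + 1) := by
          rw [div_le_div_iff₀ (by positivity) (by positivity), one_mul, mul_assoc, ← mul_pow]
          norm_num
          exact hd
        _ = 2 ^ k / 2 ^ (k + d + 1) := by
          rw [add_assoc, pow_add 2 k]
          field_simp
  have h3 : ∑ l ∈ range s, min ((2 : ℝ) ^ l / 2 ^ k) (2 ^ k / 2 ^ l) ≤ 3 := by
    refine (sum_min_two_pow_le k s).trans ?_
    split_ifs with h
    · have : (2 : ℝ) ^ s / 2 ^ k ≤ 1 :=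
        div_le_one_of_le₀ (pow_le_pow_right₀ (by norm_num) h) (by positivity)
      linarith
    · have : (0 : ℝ) ≤ 2 * 2 ^ k / 2 ^ s := by positivity
      linarith
  have h4 : ∑ l : Fin s, (2 / B : ℝ) ^ (l : ℕ) * topSum (B ^ (l : ℕ)) u ≤ 3 := by
    refine (sum_le_sum fun (l : Fin s) _ => key l).trans ?_
    rwa [Fin.sum_univ_eq_sum_range
      (fun l : ℕ => min ((2 : ℝ) ^ l / 2 ^ k) (2 ^ k / 2 ^ l)) s]
  rw [multiscaleNorm]
  linarith

/-- If for each `k ∈ K` the vector has at least `B ^ k` entries of size at least `2⁻ᵏ`, then its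
norm is at least `|K| / 2`. -/
theorem card_div_two_le_multiscaleNorm (hB : 0 < B) (K : Finset (Fin s))
    (D : Fin s → Finset (Fin n)) (hD : ∀ k ∈ K, B ^ (k : ℕ) ≤ (D k).card)
    (hu : ∀ k ∈ K, ∀ j ∈ D k, (1 / 2 : ℝ) ^ (k : ℕ) ≤ |u j|) :
    (K.card : ℝ) / 2 ≤ multiscaleNorm s B u := by
  have hB0 : (0 : ℝ) < B := by exact_mod_cast hB
  have h : (K.card : ℝ) ≤ ∑ l : Fin s, (2 / B : ℝ) ^ (l : ℕ) * topSum (B ^ (l : ℕ)) u := by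
    calc (K.card : ℝ) = ∑ l ∈ K, (1 : ℝ) := by simp
      _ ≤ ∑ l ∈ K, (2 / B : ℝ) ^ (l : ℕ) * topSum (B ^ (l : ℕ)) u := by
        refine sum_le_sum fun l hl => ?_
        calc (1 : ℝ) = (2 / B : ℝ) ^ (l : ℕ) * ((B ^ (l : ℕ) : ℕ) * (1 / 2 : ℝ) ^ (l : ℕ)) := by
              push_cast
              rw [← mul_pow, ← mul_pow]
              field_simp
              simp
          _ ≤ _ := mul_le_mul_of_nonneg_left (mul_le_topSum (hD l hl) (hu l hl)) (by positivity)
      _ ≤ _ := sum_le_sum_of_subset_of_nonneg (subset_univ _) fun _ _ _ =>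
        mul_nonneg (by positivity) (topSum_nonneg _ _)
  rw [multiscaleNorm]
  linarith

end MultiscaleNorm

theorem exists_partial_map_with_fiber_card {T : Type*} [Fintype T] {n : ℕ} (M : T → ℕ)
    (hM : ∑ a, M a ≤ n) :
    ∃ t : Fin n → Option T, ∀ a, (univ.filter fun j => t j = some a).card = M a := by
  obtain ⟨e⟩ : Nonempty ((Σ a : T, Fin (M a)) ↪ Fin n) :=
    Function.Embedding.nonempty_of_card_le (by simpa using hM)
  refine ⟨fun j => (Function.partialInv e j).map Sigma.fst, fun a => ?_⟩
  have h : (univ.filter fun j => (Function.partialInv e j).map Sigma.fst = some a) =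
      (univ : Finset (Fin (M a))).image fun r => e ⟨a, r⟩ := by
    ext j
    simp only [mem_filter, mem_univ, true_and, mem_image, Option.map_eq_some_iff]
    constructor
    · rintro ⟨⟨b, r⟩, hx, rfl⟩
      exact ⟨r, (e.injective.isPartialInv _ _).1 hx⟩
    · rintro ⟨r, rfl⟩
      exact ⟨⟨a, r⟩, Function.partialInv_left e.injective _, rfl⟩
  rw [h, card_image_of_injective _ (fun r r' hr => by simpa using e.injective hr)]
  simp

section GapInstance

variable {n m s B : ℕ} (t : Fin n → Option (Fin s × Finset (Fin m)))

/-- The processing times of the gap instance: a job of type `(k, S)` has size `2⁻ᵏ` on the machines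
in `S` and cannot run elsewhere, and a job without type has size zero. -/
noncomputable def gapTime (i : Fin m) (j : Fin n) : ℝ≥0∞ :=
  match t j with
  | none => 0
  | some a => if i ∈ a.2 then ENNReal.ofReal ((1 / 2) ^ (a.1 : ℕ)) else ⊤

/-- The configuration of machine `i` for class `k`; machine `i₀` also takes the jobs without
type. -/
noncomputable def gapConfig (i₀ i : Fin m) (k : Fin s) : Finset (Fin n) :=
  univ.filter fun j => (t j = none ∧ i = i₀) ∨ ∃ S, t j = some (k, S) ∧ i ∈ S

variable {t}

theorem gapTime_of_none {i : Fin m} {j : Fin n} (h : t j = none) : gapTime t i j = 0 := by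
  simp [gapTime, h]

theorem gapTime_of_mem {i : Fin m} {j : Fin n} {k : Fin s} {S : Finset (Fin m)}
    (h : t j = some (k, S)) (hi : i ∈ S) :
    gapTime t i j = ENNReal.ofReal ((1 / 2) ^ (k : ℕ)) := by
  simp [gapTime, h, hi]

theorem gapTime_of_notMem {i : Fin m} {j : Fin n} {k : Fin s} {S : Finset (Fin m)}
    (h : t j = some (k, S)) (hi : i ∉ S) : gapTime t i j = ⊤ := by
  simp [gapTime, h, hi]

theorem gapTime_ne_top_of_mem_gapConfig {i₀ i : Fin m} {k : Fin s} {j : Fin n}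
    (hj : j ∈ gapConfig t i₀ i k) : gapTime t i j ≠ ⊤ := by
  rcases (mem_filter.1 hj).2 with ⟨h, _⟩ | ⟨S, h, hi⟩
  · simp [gapTime_of_none h]
  · simp [gapTime_of_mem h hi]

theorem card_class_le {R : ℕ} (k : Fin s)
    (ht : ∀ S, (univ.filter fun j => t j = some (k, S)).card ≤ R) :
    (univ.filter fun j => ∃ S, t j = some (k, S)).card ≤ 2 ^ m * R := by
  have h : (univ.filter fun j => ∃ S, t j = some (k, S)) =
      (univ : Finset (Finset (Fin m))).biUnion fun S => univ.filter fun j => t j = some (k, S) := by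
    ext j
    simp
  rw [h]
  refine (card_biUnion_le_card_mul _ _ R fun S _ => ht S).trans ?_
  simp

theorem multiscaleNorm_gapConfig_le {R : ℕ} (hR : 1 ≤ R) (hB : 4 * (2 ^ m * R) ≤ B)
    (k : Fin s) (ht : ∀ S, (univ.filter fun j => t j = some (k, S)).card ≤ R * B ^ (k : ℕ))
    (i₀ i : Fin m) :
    multiscaleNorm s B
      (fun j => if j ∈ gapConfig t i₀ i k then (gapTime t i j).toReal else 0) ≤ 2 := by
  refine multiscaleNorm_le_two (R := 2 ^ m * R) (k := k)
    (D := univ.filter fun j => ∃ S, t j = some (k, S))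
    (Nat.mul_pos (by positivity) hR) hB (fun j => ?_) (fun j hj => ?_) ?_
  · split_ifs with h
    · rcases (mem_filter.1 h).2 with ⟨h, _⟩ | ⟨S, h, hi⟩
      · rw [gapTime_of_none h]
        simp
      · rw [gapTime_of_mem h hi, ENNReal.toReal_ofReal (by positivity),
          abs_of_nonneg (by positivity)]
    · rw [abs_zero]
      positivity
  · split_ifs with h
    · rcases (mem_filter.1 h).2 with ⟨h, _⟩ | ⟨S, h, hi⟩
      · rw [gapTime_of_none h]
        simp
      · exact absurd (mem_filter.2 ⟨mem_univ _, S, h⟩) hj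
    · rfl
  · rw [mul_assoc]
    exact card_class_le k ht

/-- The uniform distribution over the class configurations is a feasible configuration LP
solution. -/
theorem exists_configuration_lp_solution {R : ℕ} (hs : 0 < s) (hR : 1 ≤ R)
    (hB : 4 * (2 ^ m * R) ≤ B)
    (ht : ∀ k S, (univ.filter fun j => t j = some (k, S)).card ≤ R * B ^ (k : ℕ))
    (htS : ∀ j k S, t j = some (k, S) → S.card = s) (i₀ : Fin m) :
    ∃ x : Fin m → Finset (Fin n) → ℝ,
      (∀ i C, 0 ≤ x i C ∧ x i C ≤ 1) ∧
      (∀ i, ∑ C : Finset (Fin n), x i C ≤ 1) ∧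
      (∀ j : Fin n, ∑ i : Fin m, ∑ C : Finset (Fin n), (if j ∈ C then x i C else 0) = 1) ∧
      (∀ i C, ((∃ j ∈ C, gapTime t i j = ⊤) ∨
        2 < multiscaleNorm s B (fun j => if j ∈ C then (gapTime t i j).toReal else 0)) →
          x i C = 0) := by
  have hs0 : (s : ℝ) ≠ 0 := by exact_mod_cast hs.ne'
  let x : Fin m → Finset (Fin n) → ℝ := fun i C =>
    ∑ k : Fin s, if C = gapConfig t i₀ i k then (s : ℝ)⁻¹ else 0
  have hx0 : ∀ i C, 0 ≤ x i C := fun i C => sum_nonneg fun k _ => by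
    split_ifs <;> positivity
  have hx1 : ∀ i, ∑ C : Finset (Fin n), x i C = 1 := by
    intro i
    simp only [x]
    rw [sum_comm]
    simp [hs0]
  refine ⟨x, fun i C => ⟨hx0 i C, ?_⟩, fun i => (hx1 i).le, fun j => ?_, fun i C h => ?_⟩
  · rw [← hx1 i]
    exact single_le_sum (fun C _ => hx0 i C) (mem_univ C)
  · have h1 : ∀ i, ∑ C : Finset (Fin n), (if j ∈ C then x i C else 0) =
        ∑ k : Fin s, if j ∈ gapConfig t i₀ i k then (s : ℝ)⁻¹ else 0 := by
      intro i
      rw [← sum_filter]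
      simp only [x]
      rw [sum_comm]
      refine sum_congr rfl fun k _ => ?_
      rw [sum_ite_eq']
      simp
    simp only [h1]
    rcases htj : t j with _ | ⟨k, S⟩
    · have h2 : ∀ i k, j ∈ gapConfig t i₀ i k ↔ i = i₀ := by
        intro i k
        simp [gapConfig, htj]
      simp only [h2]
      rw [sum_comm]
      simp [hs0]
    · have h2 : ∀ i k', j ∈ gapConfig t i₀ i k' ↔ k = k' ∧ i ∈ S := by
        intro i k'
        simp only [gapConfig, htj, mem_filter, mem_univ, true_and, reduceCtorEq, false_and,
          false_or, Option.some.injEq, Prod.mk.injEq]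
        constructor
        · rintro ⟨S', ⟨rfl, rfl⟩, hi⟩
          exact ⟨rfl, hi⟩
        · rintro ⟨rfl, hi⟩
          exact ⟨S, ⟨rfl, rfl⟩, hi⟩
      simp only [h2, ite_and]
      simp [htS j k S htj, hs0]
  · refine sum_eq_zero fun k _ => if_neg ?_
    rintro rfl
    rcases h with ⟨j, hj, hp⟩ | h
    · exact gapTime_ne_top_of_mem_gapConfig hj hp
    · exact h.not_ge (multiscaleNorm_gapConfig_le hR hB k (ht k) i₀ i)

/-- In every assignment, more than `m - s` machines receive at least `B ^ k` jobs of class `k`. -/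
theorem lt_card_loaded_machines {k : Fin s} (hs : 0 < s)
    (ht : ∀ S : Finset (Fin m), S.card = s →
      s * B ^ (k : ℕ) ≤ (univ.filter fun j => t j = some (k, S)).card)
    (ρ : Fin n → Fin m) (hρ : ∀ j, gapTime t (ρ j) j ≠ ⊤) :
    m < s + (univ.filter fun i : Fin m =>
      B ^ (k : ℕ) ≤ (univ.filter fun j => ρ j = i ∧ ∃ S, t j = some (k, S)).card).card := by
  by_contra! hcon
  set A := univ.filter fun i : Fin m =>
    B ^ (k : ℕ) ≤ (univ.filter fun j => ρ j = i ∧ ∃ S, t j = some (k, S)).card with hA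
  have hAc : s ≤ Aᶜ.card := by
    rw [card_compl, Fintype.card_fin]
    omega
  obtain ⟨S, hSA, hS⟩ := exists_subset_card_eq hAc
  have hmaps : ∀ j ∈ univ.filter (fun j => t j = some (k, S)), ρ j ∈ S := by
    intro j hj
    by_contra h
    exact hρ j (gapTime_of_notMem (mem_filter.1 hj).2 h)
  have hlt : (univ.filter fun j => t j = some (k, S)).card < ∑ _i ∈ S, B ^ (k : ℕ) := by
    rw [card_eq_sum_card_fiberwise hmaps]
    refine sum_lt_sum_of_nonempty (card_pos.1 (hS ▸ hs)) fun i hi => ?_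
    have h1 : (univ.filter fun j => ρ j = i ∧ ∃ S, t j = some (k, S)).card < B ^ (k : ℕ) := by
      have := hSA hi
      rw [mem_compl, hA, mem_filter] at this
      simpa using this
    refine lt_of_le_of_lt (card_le_card fun j hj => ?_) h1
    simp only [mem_filter, mem_univ, true_and] at hj ⊢
    exact ⟨hj.2, S, hj.1⟩
  rw [sum_const, hS, smul_eq_mul] at hlt
  exact hlt.not_ge (ht S hS)

theorem exists_machine_multiscaleNorm_ge (hs : 0 < s) (hsm : 2 * s ≤ m) (hB : 0 < B)
    (ht : ∀ (k : Fin s) (S : Finset (Fin m)), S.card = s →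
      s * B ^ (k : ℕ) ≤ (univ.filter fun j => t j = some (k, S)).card)
    (ρ : Fin n → Fin m) (hρ : ∀ j, gapTime t (ρ j) j ≠ ⊤) :
    ∃ i : Fin m, (s : ℝ) / 4 ≤
      multiscaleNorm s B (fun j => if ρ j = i then (gapTime t i j).toReal else 0) := by
  let D : Fin m → Fin s → Finset (Fin n) := fun i k =>
    univ.filter fun j => ρ j = i ∧ ∃ S, t j = some (k, S)
  have hcount : ∑ i : Fin m, (univ.filter fun k : Fin s => B ^ (k : ℕ) ≤ (D i k).card).card =
      ∑ k : Fin s, (univ.filter fun i : Fin m => B ^ (k : ℕ) ≤ (D i k).card).card := by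
    simp only [card_filter]
    exact sum_comm
  obtain ⟨i, hi⟩ : ∃ i : Fin m,
      s ≤ 2 * (univ.filter fun k : Fin s => B ^ (k : ℕ) ≤ (D i k).card).card := by
    by_contra! h
    have hm : (univ : Finset (Fin m)).Nonempty := ⟨⟨0, by omega⟩, mem_univ _⟩
    have h1 := sum_lt_sum_of_nonempty hm fun i _ => h i
    rw [← mul_sum, hcount, mul_sum, sum_const, card_univ, Fintype.card_fin, smul_eq_mul] at h1
    have h2 : ∑ _k : Fin s, m ≤
        ∑ k : Fin s, 2 * (univ.filter fun i : Fin m => B ^ (k : ℕ) ≤ (D i k).card).card := by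
      refine sum_le_sum fun k _ => ?_
      have := lt_card_loaded_machines hs (ht k) ρ hρ
      simp only [D]
      omega
    rw [sum_const, card_univ, Fintype.card_fin, smul_eq_mul, mul_comm] at h2
    exact h1.not_ge h2
  refine ⟨i, le_trans ?_ (card_div_two_le_multiscaleNorm hB
    (univ.filter fun k : Fin s => B ^ (k : ℕ) ≤ (D i k).card) (D i)
    (fun k hk => (mem_filter.1 hk).2) fun k _ j hj => ?_)⟩
  · have : (s : ℝ) ≤
        2 * ((univ.filter fun k : Fin s => B ^ (k : ℕ) ≤ (D i k).card).card : ℝ) := by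
      exact_mod_cast hi
    linarith
  · obtain ⟨hij, S, hS⟩ := (mem_filter.1 hj).2
    have hmem : i ∈ S := by
      by_contra h
      exact hρ j (hij ▸ gapTime_of_notMem hS h)
    rw [if_pos hij, gapTime_of_mem hS hmem, ENNReal.toReal_ofReal (by positivity)]
    exact le_abs_self _

end GapInstance

theorem exists_job_types {n m s B : ℕ} (hB : 2 ^ m * s + 1 ≤ B) (hn : B ^ s ≤ n) :
    ∃ t : Fin n → Option (Fin s × Finset (Fin m)), ∀ k S,
      (univ.filter fun j => t j = some (k, S)).card =
        if S.card = s then s * B ^ (k : ℕ) else 0 := by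
  obtain ⟨t, ht⟩ := exists_partial_map_with_fiber_card (n := n)
    (fun a : Fin s × Finset (Fin m) => if a.2.card = s then s * B ^ (a.1 : ℕ) else 0) (by
      rw [Fintype.sum_prod_type]
      calc ∑ k : Fin s, ∑ S : Finset (Fin m), (if S.card = s then s * B ^ (k : ℕ) else 0)
          ≤ ∑ k : Fin s, ∑ _S : Finset (Fin m), s * B ^ (k : ℕ) :=
            sum_le_sum fun k _ => sum_le_sum fun S _ => by split_ifs <;> simp
        _ = ∑ k : Fin s, (2 ^ m * s) * B ^ (k : ℕ) :=
            sum_congr rfl fun k _ => by simp [mul_assoc]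
        _ = (2 ^ m * s) * ∑ k ∈ range s, B ^ k := by
            rw [← mul_sum, Fin.sum_univ_eq_sum_range (fun k => B ^ k)]
        _ ≤ (B - 1) * ∑ k ∈ range s, B ^ k := Nat.mul_le_mul_right _ (by omega)
        _ = B ^ s - 1 := by
            obtain ⟨b, rfl⟩ : ∃ b, B = b + 1 := ⟨B - 1, by omega⟩
            have := geom_sum_mul_add b s
            rw [Nat.add_sub_cancel, mul_comm]
            omega
        _ ≤ n := by omega)
  exact ⟨t, fun k S => by convert ht (k, S)⟩

theorem pow_pow_half_le {n m : ℕ} (hn : n ≠ 0) (hm : 4 ≤ m)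
    (hmn : (m : ℝ) ≤ Real.sqrt (Real.log n)) : (2 ^ (m + m / 2 + 2)) ^ (m / 2) ≤ n := by
  have hexp : (m + m / 2 + 2) * (m / 2) ≤ m ^ 2 := by
    have h : 2 * (m / 2) ≤ m := by omega
    calc (m + m / 2 + 2) * (m / 2) ≤ (2 * m) * (m / 2) := Nat.mul_le_mul_right _ (by omega)
      _ = m * (2 * (m / 2)) := by ring
      _ ≤ m ^ 2 := by
        rw [sq]
        exact Nat.mul_le_mul_left _ h
  have hlog : ((m ^ 2 : ℕ) : ℝ) ≤ Real.log n := by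
    push_cast
    exact (Real.le_sqrt' (by positivity)).1 hmn
  rw [← pow_mul]
  refine (Nat.pow_le_pow_right (by norm_num) hexp).trans ?_
  have hn0 : (0 : ℝ) < n := by exact_mod_cast Nat.pos_of_ne_zero hn
  have : ((2 : ℝ)) ^ (m ^ 2) ≤ n := by
    calc (2 : ℝ) ^ (m ^ 2) ≤ Real.exp 1 ^ (m ^ 2) := by
          gcongr
          linarith [Real.add_one_le_exp (1 : ℝ)]
      _ = Real.exp ((m ^ 2 : ℕ) : ℝ) := by rw [← Real.exp_nat_mul, mul_one]
      _ ≤ Real.exp (Real.log n) := Real.exp_le_exp.2 hlog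
      _ = n := Real.exp_log hn0
  exact_mod_cast this

/-- there is a constant `c > 0` such that for all sufficiently large `n`
there is a GMP instance with `n` jobs, `m = ⌊√(log n)⌋` machines, processing times
`p i j ∈ ℝ≥0 ∪ {∞}` (encoded by `ℝ≥0∞`), and a symmetric monotone norm `ψ` on `ℝ^n`
(used on every machine) such that:
(1) the configuration LP with threshold `T = 2` is feasible, where a configuration `C`
containing a job of infinite size on `i`, or of finite load `ψ(p_i[C]) > 2`, must get
`x i C = 0`; and
(2) every assignment `ρ` of jobs to machines using only finite processing times has some
machine of load at least `c·√(log n)`.  Hence the configuration LP has integrality gap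
`Ω(√(log n))`. -/
theorem gmp_configuration_lp_integrality_gap :
    ∃ c : ℝ, 0 < c ∧ ∃ N : ℕ, ∀ n : ℕ, N ≤ n →
      ∃ (p : Fin ⌊Real.sqrt (Real.log n)⌋₊ → Fin n → ℝ≥0∞)
        (ψ : (Fin n → ℝ) → ℝ),
        -- ψ is a norm:
        (∀ u : Fin n → ℝ, 0 ≤ ψ u) ∧
        (∀ u : Fin n → ℝ, ψ u = 0 ↔ u = 0) ∧
        (∀ (a : ℝ) (u : Fin n → ℝ), ψ (a • u) = |a| * ψ u) ∧
        (∀ u v : Fin n → ℝ, ψ (u + v) ≤ ψ u + ψ v) ∧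
        -- ψ is symmetric:
        (∀ (e : Equiv.Perm (Fin n)) (u : Fin n → ℝ), ψ (u ∘ e) = ψ u) ∧
        -- ψ is monotone:
        (∀ u v : Fin n → ℝ, (∀ j, 0 ≤ u j) → (∀ j, u j ≤ v j) → ψ u ≤ ψ v) ∧
        -- (1) the configuration LP with threshold T = 2 is feasible:
        (∃ x : Fin ⌊Real.sqrt (Real.log n)⌋₊ → Finset (Fin n) → ℝ,
          (∀ i C, 0 ≤ x i C ∧ x i C ≤ 1) ∧
          (∀ i, ∑ C : Finset (Fin n), x i C ≤ 1) ∧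
          (∀ j : Fin n,
            ∑ i : Fin ⌊Real.sqrt (Real.log n)⌋₊, ∑ C : Finset (Fin n),
              (if j ∈ C then x i C else 0) = 1) ∧
          (∀ i C, ((∃ j ∈ C, p i j = ⊤) ∨
              2 < ψ (fun j => if j ∈ C then (p i j).toReal else 0)) → x i C = 0)) ∧
        -- (2) every integral assignment has load ≥ c·√(log n) on some machine:
        (∀ ρ : Fin n → Fin ⌊Real.sqrt (Real.log n)⌋₊,
          (∀ j, p (ρ j) j ≠ ⊤) →
          ∃ i : Fin ⌊Real.sqrt (Real.log n)⌋₊,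
            c * Real.sqrt (Real.log n) ≤
              ψ (fun j => if ρ j = i then (p i j).toReal else 0)) := by
  obtain ⟨N, hN⟩ : ∃ N : ℕ, ∀ n : ℕ, N ≤ n → (4 : ℝ) ≤ Real.sqrt (Real.log n) :=
    Filter.eventually_atTop.1 ((Real.tendsto_sqrt_atTop.comp
      (Real.tendsto_log_atTop.comp tendsto_natCast_atTop_atTop)).eventually_ge_atTop 4)
  refine ⟨1 / 20, by norm_num, N, fun n hn => ?_⟩
  have h4 := hN n hn
  have hn0 : n ≠ 0 := by
    rintro rfl
    norm_num at h4
  have hfl : (⌊Real.sqrt (Real.log n)⌋₊ : ℝ) ≤ Real.sqrt (Real.log n) :=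
    Nat.floor_le (Real.sqrt_nonneg _)
  have hlt : Real.sqrt (Real.log n) < ⌊Real.sqrt (Real.log n)⌋₊ + 1 := Nat.lt_floor_add_one _
  have hm : 4 ≤ ⌊Real.sqrt (Real.log n)⌋₊ := Nat.le_floor (by exact_mod_cast h4)
  generalize ⌊Real.sqrt (Real.log n)⌋₊ = m at *
  have hB := pow_pow_half_le hn0 hm hfl
  obtain ⟨s, hs⟩ : ∃ s, s = m / 2 := ⟨_, rfl⟩
  rw [← hs] at hB
  have hs0 : 0 < s := by omega
  have hB4 : 4 * (2 ^ m * s) ≤ 2 ^ (m + s + 2) := by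
    have := (Nat.lt_two_pow_self (n := s)).le
    calc 4 * (2 ^ m * s) ≤ 4 * (2 ^ m * 2 ^ s) := by gcongr
      _ = 2 ^ (m + s + 2) := by ring
  generalize 2 ^ (m + s + 2) = B at hB hB4
  have hpos : 0 < 2 ^ m * s := by positivity
  obtain ⟨t, ht⟩ := exists_job_types (m := m) (by omega) hB
  refine ⟨gapTime t, multiscaleNorm s B, multiscaleNorm_nonneg s B,
    fun u => multiscaleNorm_eq_zero_iff hs0, multiscaleNorm_smul, multiscaleNorm_add_le,
    multiscaleNorm_comp_perm, fun u v => multiscaleNorm_mono,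
    exists_configuration_lp_solution hs0 hs0 hB4 (fun k S => ?_) (fun j k S hj => ?_)
      ⟨0, by omega⟩, fun ρ hρ => ?_⟩
  · rw [ht]
    split_ifs <;> simp
  · by_contra h
    have hc := ht k S
    rw [if_neg h, card_eq_zero] at hc
    exact notMem_empty j (hc ▸ mem_filter.2 ⟨mem_univ j, hj⟩)
  · obtain ⟨i, hi⟩ := exists_machine_multiscaleNorm_ge (B := B) hs0 (by omega) (by omega)
      (fun k S hS => by rw [ht, if_pos hS]) ρ hρ
    refine ⟨i, le_trans ?_ hi⟩
    have h3 : m ≤ 2 * s + 1 := by omega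
    have h3' : (m : ℝ) ≤ 2 * s + 1 := by exact_mod_cast h3
    have h5 : (2 : ℝ) ≤ s := by
      have : 2 ≤ s := by omega
      exact_mod_cast this
    linarith
end

section
/- For every sufficiently large positive integer n and every positive integer m with √(log n) ≤ m ≤ 2√(log n), there exists an (n, m, ℓ, β) set-system with ℓ = ⌊m/10⌋ and β = e^{−m}. -/
open Finset

/-- `(U; A_1, …, A_m)` (with `U = Fin n`) is an `(n, m, ℓ, β)` set-system if for every
index set `I ⊆ [m]` with `|I| ≤ ℓ` and every choice of sets `B i` for `i ∈ I`, each equal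
to `A i` or its complement, the union `⋃_{i ∈ I} B i` has at most `(1 - β) n` elements. -/
def IsSetSystem (n m ℓ : ℕ) (β : ℝ) (A : Fin m → Finset (Fin n)) : Prop :=
  ∀ I : Finset (Fin m), I.card ≤ ℓ →
    ∀ B : Fin m → Finset (Fin n),
      (∀ i ∈ I, B i = A i ∨ B i = (A i)ᶜ) →
      ((I.biUnion B).card : ℝ) ≤ (1 - β) * n

/-- In the periodic extension of the subsets of a cube, a choice of sets or complements misses
a full residue class modulo `2 ^ m`. -/
theorem exists_card_biUnion_add_div_le (n m : ℕ) :
    ∃ A : Fin m → Finset (Fin n), ∀ (I : Finset (Fin m)) (B : Fin m → Finset (Fin n)),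
      (∀ i ∈ I, B i = A i ∨ B i = (A i)ᶜ) → (I.biUnion B).card + n / 2 ^ m ≤ n := by
  have hM : 0 < 2 ^ m := by positivity
  let e : (Fin m → Bool) ≃ Fin (2 ^ m) := Fintype.equivFinOfCardEq (by simp)
  let A : Fin m → Finset (Fin n) := fun i =>
    univ.filter fun x => e.symm ⟨(x : ℕ) % 2 ^ m, Nat.mod_lt _ hM⟩ i = true
  refine ⟨A, fun I B hB => ?_⟩
  let r : Fin (2 ^ m) := e fun i => if B i = A i then false else true
  have hlt (k : Fin (n / 2 ^ m)) : (r : ℕ) + 2 ^ m * k < n := by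
    have h₁ : 2 ^ m * ((k : ℕ) + 1) ≤ 2 ^ m * (n / 2 ^ m) := Nat.mul_le_mul_left _ k.2
    have h₂ := Nat.mul_div_le n (2 ^ m)
    have h₃ := r.2
    rw [mul_add, mul_one] at h₁
    omega
  let g : Fin (n / 2 ^ m) → Fin n := fun k => ⟨r + 2 ^ m * k, hlt k⟩
  have hg : Function.Injective g := fun a b hab => by
    have h : (r : ℕ) + 2 ^ m * a = r + 2 ^ m * b := congrArg Fin.val hab
    exact Fin.ext (Nat.eq_of_mul_eq_mul_left hM (Nat.add_left_cancel h))
  have hmem (k : Fin (n / 2 ^ m)) (i : Fin m) : g k ∈ A i ↔ B i ≠ A i := by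
    have h : (⟨(g k : ℕ) % 2 ^ m, Nat.mod_lt _ hM⟩ : Fin (2 ^ m)) = r :=
      Fin.ext (by simp [g, Nat.mod_eq_of_lt r.2])
    have hr : g k ∈ A i ↔ e.symm r i = true := by
      simp only [A, mem_filter, mem_univ, true_and, h]
    rw [hr]
    simp [r]
  have hdisj : univ.image g ⊆ (I.biUnion B)ᶜ := by
    intro x hx
    obtain ⟨k, -, rfl⟩ := mem_image.1 hx
    rw [mem_compl, mem_biUnion]
    rintro ⟨i, hi, hk⟩
    by_cases h : B i = A i
    · exact (hmem k i).1 (h ▸ hk) h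
    · rw [(hB i hi).resolve_left h, mem_compl] at hk
      exact hk ((hmem k i).2 h)
  have hcard := card_le_card hdisj
  rw [card_image_of_injective _ hg, card_univ, Fintype.card_fin] at hcard
  have hcompl := card_add_card_compl (I.biUnion B)
  rw [Fintype.card_fin] at hcompl
  omega

theorem two_mul_two_pow_le_exp {m : ℕ} (hm : 4 ≤ m) : 2 * 2 ^ m ≤ Real.exp m := by
  have h : (2.7 : ℝ) < Real.exp 1 := lt_trans (by norm_num) Real.exp_one_gt_d9
  induction m, hm using Nat.le_induction with
  | base =>
    have : (2.7 : ℝ) ^ 4 ≤ Real.exp 1 ^ 4 := by gcongr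
    rw [← Real.exp_nat_mul, mul_one] at this
    refine le_trans ?_ this
    norm_num
  | succ m _ ih =>
    rw [Nat.cast_succ, Real.exp_add, pow_succ]
    nlinarith [Real.exp_pos (m : ℝ)]

/-- for every sufficiently large `n` and every positive integer `m` with
`√(log n) ≤ m ≤ 2√(log n)`, there exists an `(n, m, ⌊m/10⌋, e^{-m})` set-system. -/
theorem exists_set_system :
    ∃ N : ℕ, ∀ n : ℕ, N ≤ n → ∀ m : ℕ, 0 < m →
      Real.sqrt (Real.log n) ≤ (m : ℝ) → (m : ℝ) ≤ 2 * Real.sqrt (Real.log n) →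
      ∃ A : Fin m → Finset (Fin n),
        IsSetSystem n m (m / 10) (Real.exp (-(m : ℝ))) A := by
  refine ⟨⌈Real.exp 16⌉₊, fun n hn m _ hlow hupp => ?_⟩
  have hexp : Real.exp 16 ≤ n := Nat.ceil_le.1 hn
  have hn0 : (0 : ℝ) < n := (Real.exp_pos _).trans_le hexp
  have hlog : 16 ≤ Real.log n := (Real.le_log_iff_exp_le hn0).2 hexp
  have hsqrt : 4 ≤ Real.sqrt (Real.log n) := Real.le_sqrt_of_sq_le (by linarith)
  have hm4 : 4 ≤ m := by exact_mod_cast hsqrt.trans hlow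
  have hmlog : (m : ℝ) ≤ Real.log n := by
    nlinarith [Real.sq_sqrt (show 0 ≤ Real.log n by linarith)]
  have hmn : Real.exp m ≤ n := (Real.le_log_iff_exp_le hn0).1 hmlog
  have hpow := two_mul_two_pow_le_exp hm4
  have hMn : 2 ^ m ≤ n := by
    have : (2 : ℝ) ^ m ≤ n := by linarith [pow_pos (zero_lt_two' ℝ) m]
    exact_mod_cast this
  have hdiv : 1 ≤ n / 2 ^ m := (Nat.one_le_div_iff (by positivity)).2 hMn
  have hnlt : n ≤ 2 * 2 ^ m * (n / 2 ^ m) := by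
    have h := Nat.lt_mul_div_succ n (show 0 < 2 ^ m by positivity)
    nlinarith [Nat.mul_le_mul_left (2 ^ m) hdiv]
  have hbound : Real.exp (-(m : ℝ)) * n ≤ (n / 2 ^ m : ℕ) := by
    rw [Real.exp_neg, inv_mul_le_iff₀ (Real.exp_pos _)]
    calc (n : ℝ) ≤ 2 * 2 ^ m * (n / 2 ^ m : ℕ) := by exact_mod_cast hnlt
      _ ≤ Real.exp m * (n / 2 ^ m : ℕ) := by gcongr
  obtain ⟨A, hA⟩ := exists_card_biUnion_add_div_le n m
  refine ⟨A, fun I _ B hB => ?_⟩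
  have h : ((I.biUnion B).card : ℝ) + (n / 2 ^ m : ℕ) ≤ n := by exact_mod_cast hA I B hB
  linarith
end

section
/- Let n be sufficiently large and let m be an even integer with √(log n) ≤ m ≤ 2√(log n). Let U be a set of n elements and construct random sets A_1, …, A_m ⊆ U by, independently for each element e ∈ U, choosing a uniformly random subset J ⊆ {1,…,m} of size exactly m/2 and placing e into A_j for every j ∈ J. Then with probability at least 1 − exp(−n^{0.8}), the family (U; A_1, …, A_m) is an (n, m, ⌊m/10⌋, e^{−m}) set-system. -/
open Finset
open scoped Classical

/-- An exponential-moment bound on the number of functions `Fin n → α` for which few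
coordinates satisfy `P`. -/
theorem card_few_coordinates_le {α : Type*} [Fintype α] (P : α → Prop) (n : ℕ) (x p : ℝ)
    (hp : p * Fintype.card α ≤ ((univ.filter P).card : ℝ)) :
    ((univ.filter (fun ω : Fin n → α =>
        ((univ.filter (fun e => P (ω e))).card : ℝ) < x)).card : ℝ) ≤
      Real.exp (x - n * (p / 2)) * (Fintype.card α : ℝ) ^ n := by
  have he : Real.exp (-1) ≤ 1 / 2 := by
    rw [Real.exp_neg, one_div]
    exact inv_anti₀ (by norm_num) (by linarith [Real.add_one_le_exp 1])
  set w : α → ℝ := fun a => if P a then Real.exp (-1) else 1 with hw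
  have hprod (ω : Fin n → α) :
      ∏ e, w (ω e) = Real.exp (-((univ.filter (fun e => P (ω e))).card : ℝ)) := by
    simp only [hw]
    rw [Finset.prod_ite]
    simp [← Real.exp_nat_mul]
  have hsum : ∑ a, w a ≤ Real.exp (-(p / 2)) * Fintype.card α := by
    have h1 : ∑ a, w a =
        Fintype.card α - (1 - Real.exp (-1)) * (univ.filter P).card := by
      have : ∀ a, w a = 1 - (1 - Real.exp (-1)) * (if P a then 1 else 0) := by
        intro a
        simp only [hw]
        split_ifs <;> ring
      simp only [this, Finset.sum_sub_distrib, ← Finset.mul_sum, Finset.sum_boole]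
      simp
    have h2 := Real.add_one_le_exp (-(p / 2))
    have h3 : (0 : ℝ) ≤ (univ.filter P).card := by positivity
    have h4 : (0 : ℝ) ≤ Fintype.card α := by positivity
    rw [h1]
    nlinarith [mul_le_mul_of_nonneg_right h2 h4, mul_le_mul_of_nonneg_right he h3]
  have hw0 : ∀ a, 0 ≤ w a := fun a => by simp only [hw]; split_ifs <;> positivity
  calc ((univ.filter (fun ω : Fin n → α =>
        ((univ.filter (fun e => P (ω e))).card : ℝ) < x)).card : ℝ)
      = ∑ ω ∈ univ.filter (fun ω : Fin n → α =>
        ((univ.filter (fun e => P (ω e))).card : ℝ) < x), (1 : ℝ) := by simp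
    _ ≤ ∑ ω ∈ univ.filter (fun ω : Fin n → α =>
        ((univ.filter (fun e => P (ω e))).card : ℝ) < x), Real.exp x * ∏ e, w (ω e) := by
        refine Finset.sum_le_sum fun ω hω => ?_
        rw [hprod, ← Real.exp_add]
        exact Real.one_le_exp (by linarith [(Finset.mem_filter.1 hω).2])
    _ ≤ ∑ ω : Fin n → α, Real.exp x * ∏ e, w (ω e) :=
        Finset.sum_le_sum_of_subset_of_nonneg (Finset.filter_subset _ _) fun ω _ _ =>
          mul_nonneg (Real.exp_pos _).le (Finset.prod_nonneg fun e _ => hw0 _)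
    _ = Real.exp x * (∑ a, w a) ^ n := by rw [← Finset.mul_sum, Fintype.sum_pow]
    _ ≤ Real.exp x * (Real.exp (-(p / 2)) * Fintype.card α) ^ n := by
        gcongr
    _ = Real.exp (x - n * (p / 2)) * (Fintype.card α : ℝ) ^ n := by
        rw [mul_pow, ← Real.exp_nat_mul, ← mul_assoc, ← Real.exp_add]
        ring_nf

/-- Membership in at most `m / 10` indices can be prescribed arbitrarily for a subset of
`Fin m` of size `m / 2`. -/
theorem exists_card_half_with_trace {m : ℕ} (I S : Finset (Fin m)) (hI : I.card ≤ m / 10) :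
    ∃ J : {J : Finset (Fin m) // J.card = m / 2}, ∀ i ∈ I, (i ∈ J.1 ↔ i ∈ S) := by
  have h1 : (S ∩ I).card ≤ m / 2 :=
    (Finset.card_le_card Finset.inter_subset_right).trans (hI.trans (by omega))
  have h2 : m / 2 ≤ (S ∩ I ∪ Iᶜ).card := by
    refine le_trans ?_ (Finset.card_le_card Finset.subset_union_right)
    rw [Finset.card_compl, Fintype.card_fin]
    omega
  obtain ⟨J, hJ1, hJ2, hJ⟩ :=
    Finset.exists_subsuperset_card_eq Finset.subset_union_left h1 h2
  refine ⟨⟨J, hJ⟩, fun i hi => ⟨fun h => ?_, fun h => hJ1 (Finset.mem_inter.2 ⟨h, hi⟩)⟩⟩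
  have := hJ2 h
  simp only [Finset.mem_union, Finset.mem_inter, Finset.mem_compl] at this
  tauto

/-- A family fails to be a set-system only if some prescribed membership pattern on few
indices is realised by fewer than `β * n` elements. -/
theorem exists_rare_pattern_of_not_isSetSystem {n m ℓ : ℕ} {β : ℝ} (J : Fin n → Finset (Fin m))
    (h : ¬ IsSetSystem n m ℓ β (fun i => univ.filter (fun e : Fin n => i ∈ J e))) :
    ∃ I S : Finset (Fin m), I.card ≤ ℓ ∧
      ((univ.filter (fun e => ∀ i ∈ I, (i ∈ J e ↔ i ∈ S))).card : ℝ) < β * n := by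
  unfold IsSetSystem at h
  push Not at h
  obtain ⟨I, hI, B, hB, hlt⟩ := h
  refine ⟨I, univ.filter (fun i => B i = (univ.filter (fun e : Fin n => i ∈ J e))ᶜ), hI, ?_⟩
  have hsub : univ.filter (fun e => ∀ i ∈ I, (i ∈ J e ↔
      i ∈ univ.filter (fun i => B i = (univ.filter (fun e : Fin n => i ∈ J e))ᶜ))) ⊆
      (I.biUnion B)ᶜ := by
    intro e he
    simp only [Finset.mem_filter, Finset.mem_univ, true_and] at he
    simp only [Finset.mem_compl, Finset.mem_biUnion, not_exists, not_and]
    intro i hi hei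
    by_cases hc : B i = (univ.filter (fun e : Fin n => i ∈ J e))ᶜ
    · have := (he i hi).2 hc
      rw [hc] at hei
      simp [this] at hei
    · have := (hB i hi).resolve_right hc
      rw [this] at hei
      exact hc ((he i hi).1 (by simpa using hei))
  have h1 : ((univ.filter (fun e => ∀ i ∈ I, (i ∈ J e ↔
      i ∈ univ.filter (fun i => B i = (univ.filter (fun e : Fin n => i ∈ J e))ᶜ)))).card : ℝ) ≤
      ((I.biUnion B)ᶜ).card := by exact_mod_cast Finset.card_le_card hsub
  have h2 : ((I.biUnion B).card : ℝ) + ((I.biUnion B)ᶜ).card = n := by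
    exact_mod_cast (Finset.card_add_card_compl (I.biUnion B)).trans (Fintype.card_fin n)
  linarith

/-- A union bound over all membership patterns. -/
theorem card_not_isSetSystem_le (n m : ℕ) (β : ℝ) :
    ((univ.filter (fun ω : Fin n → {J : Finset (Fin m) // J.card = m / 2} =>
      ¬ IsSetSystem n m (m / 10) β
        (fun i => univ.filter (fun e : Fin n => i ∈ (ω e).1)))).card : ℝ) ≤
      4 ^ m * (Real.exp (β * n - n * ((2 ^ m)⁻¹ / 2)) *
        (Fintype.card {J : Finset (Fin m) // J.card = m / 2} : ℝ) ^ n) := by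
  let pats : Finset (Finset (Fin m) × Finset (Fin m)) := univ.filter (fun q => q.1.card ≤ m / 10)
  let rare : Finset (Fin m) × Finset (Fin m) →
      Finset (Fin n → {J : Finset (Fin m) // J.card = m / 2}) := fun q =>
    univ.filter (fun ω =>
      ((univ.filter (fun e => ∀ i ∈ q.1, (i ∈ (ω e).1 ↔ i ∈ q.2))).card : ℝ) < β * n)
  have hsub : univ.filter (fun ω : Fin n → {J : Finset (Fin m) // J.card = m / 2} =>
      ¬ IsSetSystem n m (m / 10) β
        (fun i => univ.filter (fun e : Fin n => i ∈ (ω e).1))) ⊆ pats.biUnion rare := by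
    intro ω hω
    obtain ⟨I, S, hI, h⟩ :=
      exists_rare_pattern_of_not_isSetSystem (fun e => (ω e).1) (Finset.mem_filter.1 hω).2
    exact Finset.mem_biUnion.2 ⟨(I, S), by simpa [pats] using hI, by simpa [rare] using h⟩
  have hrare : ∀ q ∈ pats, ((rare q).card : ℝ) ≤ Real.exp (β * n - n * ((2 ^ m)⁻¹ / 2)) *
        (Fintype.card {J : Finset (Fin m) // J.card = m / 2} : ℝ) ^ n := by
    intro q hq
    obtain ⟨J, hJ⟩ := exists_card_half_with_trace q.1 q.2 (Finset.mem_filter.1 hq).2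
    refine le_trans (le_of_eq ?_) (card_few_coordinates_le
      (fun J : {J : Finset (Fin m) // J.card = m / 2} => ∀ i ∈ q.1, (i ∈ J.1 ↔ i ∈ q.2))
      n (β * n) (2 ^ m)⁻¹ ?_)
    · simp only [rare]
      congr!
    refine le_trans (b := 1) ?_ (Nat.one_le_cast.2 (Finset.card_pos.2 ⟨J, by simpa using hJ⟩))
    rw [inv_mul_le_one₀ (by positivity)]
    have := Fintype.card_subtype_le (fun J : Finset (Fin m) => J.card = m / 2)
    rw [Fintype.card_finset, Fintype.card_fin] at this
    exact_mod_cast this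
  have hpats : (pats.card : ℝ) ≤ 4 ^ m := by
    have : pats.card ≤ 4 ^ m := by
      refine (Finset.card_le_univ _).trans (le_of_eq ?_)
      rw [Fintype.card_prod, Fintype.card_finset, Fintype.card_fin, ← mul_pow]
      norm_num
    exact_mod_cast this
  calc _ ≤ ((pats.biUnion rare).card : ℝ) := by exact_mod_cast Finset.card_le_card hsub
    _ ≤ ∑ q ∈ pats, ((rare q).card : ℝ) := by exact_mod_cast Finset.card_biUnion_le
    _ ≤ pats.card * (Real.exp (β * n - n * ((2 ^ m)⁻¹ / 2)) *
        (Fintype.card {J : Finset (Fin m) // J.card = m / 2} : ℝ) ^ n) := by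
      rw [← nsmul_eq_mul]
      exact Finset.sum_le_card_nsmul _ _ _ hrare
    _ ≤ _ := by gcongr

theorem four_pow_mul_exp_le {n m : ℕ} (hn : Real.exp 400 ≤ n)
    (h1 : Real.sqrt (Real.log n) ≤ m) (h2 : (m : ℝ) ≤ 2 * Real.sqrt (Real.log n)) :
    4 ^ m * Real.exp (Real.exp (-(m : ℝ)) * n - n * ((2 ^ m)⁻¹ / 2)) ≤
      Real.exp (-((n : ℝ) ^ (0.8 : ℝ))) := by
  have hn0 : (0 : ℝ) < n := (Real.exp_pos _).trans_le hn
  set L := Real.log n with hL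
  have hL400 : 400 ≤ L := (Real.le_log_iff_exp_le hn0).2 hn
  have hs : 20 ≤ Real.sqrt L := Real.le_sqrt_of_sq_le (by linarith)
  have hss : Real.sqrt L * Real.sqrt L = L := Real.mul_self_sqrt (by linarith)
  have hmL : (m : ℝ) ≤ L / 10 := by nlinarith
  have hm20 : 20 ≤ m := by exact_mod_cast hs.trans h1
  have hnL : (n : ℝ) = Real.exp L := (Real.exp_log hn0).symm
  have hβ : Real.exp (-(m : ℝ)) ≤ (2 ^ m)⁻¹ / 4 := by
    have he : (2.7 : ℝ) ≤ Real.exp 1 := by linarith [Real.exp_one_gt_d9]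
    have h5 : (4 : ℝ) * 2 ^ m ≤ Real.exp m := by
      obtain ⟨k, rfl⟩ := Nat.exists_eq_add_of_le hm20
      rw [← Real.exp_one_pow]
      calc (4 : ℝ) * 2 ^ (20 + k) = (4 * 2 ^ 20) * 2 ^ k := by ring
        _ ≤ 2.7 ^ 20 * 2.7 ^ k := by gcongr <;> norm_num
        _ = 2.7 ^ (20 + k) := by ring
        _ ≤ _ := by gcongr
    rw [Real.exp_neg, div_eq_mul_inv, ← mul_inv, mul_comm]
    exact inv_anti₀ (by positivity) h5
  have h2m : Real.exp (-(m : ℝ)) ≤ (2 ^ m)⁻¹ := by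
    have : (0 : ℝ) < (2 ^ m)⁻¹ := by positivity
    linarith
  have h4 : (4 : ℝ) ^ m ≤ Real.exp (2 * m) := by
    have : (4 : ℝ) ≤ Real.exp 1 * Real.exp 1 := by nlinarith [Real.exp_one_gt_d9]
    calc (4 : ℝ) ^ m ≤ (Real.exp 1 * Real.exp 1) ^ m := by gcongr
      _ = Real.exp (2 * m) := by rw [← Real.exp_add, ← Real.exp_nat_mul]; ring_nf
  have h8 : (n : ℝ) ^ (0.8 : ℝ) = Real.exp (0.8 * L) := by
    rw [Real.rpow_def_of_pos hn0, mul_comm]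
  have h9 : 8 * Real.exp (0.8 * L) ≤ n * (2 ^ m)⁻¹ := by
    calc 8 * Real.exp (0.8 * L) ≤ Real.exp (0.1 * L) * Real.exp (0.8 * L) := by
          gcongr
          linarith [Real.add_one_le_exp (0.1 * L)]
      _ = Real.exp (0.9 * L) := by rw [← Real.exp_add]; ring_nf
      _ ≤ Real.exp (L + -(m : ℝ)) := Real.exp_le_exp.2 (by linarith)
      _ = n * Real.exp (-(m : ℝ)) := by rw [Real.exp_add, ← hnL]
      _ ≤ _ := by gcongr
  have h10 := Real.add_one_le_exp (0.8 * L)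
  calc _ ≤ Real.exp (2 * m) * Real.exp (Real.exp (-(m : ℝ)) * n - n * ((2 ^ m)⁻¹ / 2)) := by
        gcongr
    _ = Real.exp (2 * m + (Real.exp (-(m : ℝ)) * n - n * ((2 ^ m)⁻¹ / 2))) := by
        rw [Real.exp_add]
    _ ≤ _ := by
        rw [h8]
        refine Real.exp_le_exp.2 ?_
        have := mul_le_mul_of_nonneg_right hβ hn0.le
        linarith

/-- the random construction (each element `e` of `U = Fin n` independently
picks a uniformly random subset `J ⊆ [m]` of size exactly `m/2`, and `e ∈ A_j` iff `j ∈ J`)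
yields an `(n, m, ⌊m/10⌋, e^{-m})` set-system with probability at least `1 - exp(-n^{0.8})`.
A sample point is a function `ω : Fin n → {J : Finset (Fin m) // J.card = m/2}`; the uniform
product measure is expressed by counting sample points. -/
theorem random_set_system :
    ∃ N : ℕ, ∀ n : ℕ, N ≤ n → ∀ m : ℕ, 0 < m → Even m →
      Real.sqrt (Real.log n) ≤ (m : ℝ) → (m : ℝ) ≤ 2 * Real.sqrt (Real.log n) →
      (1 - Real.exp (-((n : ℝ) ^ (0.8 : ℝ)))) *
          (Fintype.card (Fin n → {J : Finset (Fin m) // J.card = m / 2}) : ℝ) ≤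
        ((Finset.univ.filter
            (fun ω : Fin n → {J : Finset (Fin m) // J.card = m / 2} =>
              IsSetSystem n m (m / 10) (Real.exp (-(m : ℝ)))
                (fun i => Finset.univ.filter (fun e : Fin n => i ∈ (ω e).1)))).card : ℝ) := by
  refine ⟨⌈Real.exp 400⌉₊, fun n hn m _ _ h1 h2 => ?_⟩
  have hbad := card_not_isSetSystem_le n m (Real.exp (-(m : ℝ)))
  rw [← mul_assoc] at hbad
  have hexp := mul_le_mul_of_nonneg_right (four_pow_mul_exp_le (Nat.ceil_le.1 hn) h1 h2)
    (by positivity :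
      (0 : ℝ) ≤ (Fintype.card {J : Finset (Fin m) // J.card = m / 2} : ℝ) ^ n)
  have htotal := Finset.card_filter_add_card_filter_not
    (s := (univ : Finset (Fin n → {J : Finset (Fin m) // J.card = m / 2})))
    (fun ω => IsSetSystem n m (m / 10) (Real.exp (-(m : ℝ)))
      (fun i => univ.filter (fun e : Fin n => i ∈ (ω e).1)))
  have hcard : (Fintype.card (Fin n → {J : Finset (Fin m) // J.card = m / 2}) : ℝ) =
      (Fintype.card {J : Finset (Fin m) // J.card = m / 2} : ℝ) ^ n := by
    rw [Fintype.card_fun, Fintype.card_fin, Nat.cast_pow]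
  rw [Finset.card_univ] at htotal
  have htotal' := congrArg (Nat.cast (R := ℝ)) htotal
  rw [Nat.cast_add, hcard] at htotal'
  rw [hcard]
  linarith
end

section
/- For every sufficiently large positive integer n, every integer m with √(log n) ≤ m ≤ 2√(log n), β = e^{−m}, and every real p with e^{−0.6m} ≤ p ≤ 1, the following inequality holds: C(n, ⌈βn⌉) · n · (1 − p)^{(1−β)n} ≤ exp(3nβ·ln(1/β) − np/2) ≤ exp(−np/4) ≤ exp(−n^{0.9}), where C(a,b) denotes the binomial coefficient. -/
open Finset

/-- If `n ≤ k e^m`, then `C(n, k) ≤ (e · e^m)^k`. -/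
lemma choose_le_exp_of_le_mul_exp {n k : ℕ} {m : ℝ} (h : (n : ℝ) ≤ k * Real.exp m) :
    (Nat.choose n k : ℝ) ≤ Real.exp (k * (1 + m)) :=
  calc (Nat.choose n k : ℝ) ≤ (n : ℝ) ^ k / (k.factorial : ℝ) := Nat.choose_le_pow_div k n
    _ ≤ (k * Real.exp m) ^ k / (k.factorial : ℝ) := by gcongr
    _ = (k : ℝ) ^ k / (k.factorial : ℝ) * Real.exp (k * m) := by
        rw [mul_pow, ← Real.exp_nat_mul]; ring
    _ ≤ Real.exp k * Real.exp (k * m) := by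
        gcongr
        exact Real.pow_div_factorial_le_exp k (Nat.cast_nonneg k) k
    _ = Real.exp (k * (1 + m)) := by rw [← Real.exp_add]; ring_nf

/-- For `p ≤ 1` and `0 ≤ x`, `(1 - p)^x ≤ e^{-px}`. -/
lemma one_sub_rpow_le_exp {p x : ℝ} (hp : p ≤ 1) (hx : 0 ≤ x) :
    (1 - p) ^ x ≤ Real.exp (-(p * x)) :=
  calc (1 - p) ^ x ≤ Real.exp (-p) ^ x :=
        Real.rpow_le_rpow (by linarith) (Real.one_sub_le_exp_neg p) hx
    _ = Real.exp (-(p * x)) := by rw [← Real.exp_mul]; ring_nf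

/-- for sufficiently large `n`, any integer `m` with
`√(log n) ≤ m ≤ 2√(log n)`, `β = e^{-m}`, and any real `p` with `e^{-0.6m} ≤ p ≤ 1`:
`C(n, ⌈βn⌉) · n · (1-p)^{(1-β)n} ≤ exp(3nβ·ln(1/β) - np/2) ≤ exp(-np/4) ≤ exp(-n^{0.9})`. -/
theorem union_bound_inequality :
    ∃ N : ℕ, ∀ n : ℕ, N ≤ n → ∀ m : ℕ,
      Real.sqrt (Real.log n) ≤ (m : ℝ) → (m : ℝ) ≤ 2 * Real.sqrt (Real.log n) →
      ∀ p : ℝ, Real.exp (-0.6 * m) ≤ p → p ≤ 1 →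
      ((Nat.choose n ⌈Real.exp (-(m : ℝ)) * n⌉₊ : ℝ) * n *
            (1 - p) ^ ((1 - Real.exp (-(m : ℝ))) * n) ≤
          Real.exp (3 * n * Real.exp (-(m : ℝ)) * Real.log (1 / Real.exp (-(m : ℝ))) -
            n * p / 2)) ∧
      (Real.exp (3 * n * Real.exp (-(m : ℝ)) * Real.log (1 / Real.exp (-(m : ℝ))) -
            n * p / 2) ≤ Real.exp (-(n * p / 4))) ∧
      (Real.exp (-(n * p / 4)) ≤ Real.exp (-((n : ℝ) ^ (0.9 : ℝ)))) := by
  refine ⟨⌈Real.exp 22500⌉₊, fun n hn m hm₁ hm₂ p hp₁ hp₂ => ?_⟩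
  have hn' : Real.exp 22500 ≤ n := Nat.ceil_le.mp hn
  have hn0 : (0 : ℝ) < n := (Real.exp_pos _).trans_le hn'
  obtain ⟨L, hL⟩ : ∃ L, L = Real.log n := ⟨_, rfl⟩
  have hnL : (n : ℝ) = Real.exp L := by rw [hL, Real.exp_log hn0]
  have hL_large : 22500 ≤ L := hL ▸ (Real.le_log_iff_exp_le hn0).mpr hn'
  rw [← hL] at hm₁ hm₂
  obtain ⟨M, hM⟩ : ∃ M : ℝ, M = m := ⟨_, rfl⟩
  rw [← hM] at hm₁ hm₂ hp₁ ⊢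
  have hM_large : 150 ≤ M := (Real.le_sqrt' (by norm_num)).mpr (by linarith) |>.trans hm₁
  have hL_le : L ≤ M ^ 2 := (Real.sqrt_le_left (by linarith)).mp hm₁
  have hL_ge : M ^ 2 ≤ 4 * L := by
    nlinarith [Real.sq_sqrt (show 0 ≤ L by linarith), Real.sqrt_nonneg L]
  obtain ⟨β, hβ⟩ : ∃ β, β = Real.exp (-M) := ⟨_, rfl⟩
  have hβ0 : 0 < β := hβ ▸ Real.exp_pos _
  have hlog : Real.log (1 / β) = M := by rw [hβ, one_div, ← Real.exp_neg, neg_neg, Real.log_exp]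
  have hβM : β * Real.exp M = 1 := by rw [hβ, ← Real.exp_add]; simp
  have hβ_half : β ≤ 1 / 2 := by nlinarith [Real.add_one_le_exp M]
  have hp0 : 0 < p := (Real.exp_pos _).trans_le hp₁
  rw [← hβ, hlog]
  refine ⟨?_, Real.exp_le_exp.mpr ?_, Real.exp_le_exp.mpr (neg_le_neg ?_)⟩
  · have hk_ge := Nat.le_ceil (β * n)
    have hk_le := (Nat.ceil_lt_add_one (show 0 ≤ β * n by positivity)).le
    set k := ⌈β * n⌉₊
    have hchoose : (Nat.choose n k : ℝ) ≤ Real.exp (k * (1 + M)) := by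
      apply choose_le_exp_of_le_mul_exp
      calc (n : ℝ) = β * n * Real.exp M := by linear_combination -(n : ℝ) * hβM
        _ ≤ k * Real.exp M := by gcongr
    have hpow := one_sub_rpow_le_exp hp₂ (show 0 ≤ (1 - β) * n from
      mul_nonneg (by linarith) hn0.le)
    have hβn : 3 * M ≤ β * n := by
      rw [hβ, hnL, ← Real.exp_add]
      nlinarith [Real.add_one_le_exp (-M + L)]
    calc (Nat.choose n k : ℝ) * n * (1 - p) ^ ((1 - β) * n)
        ≤ Real.exp (k * (1 + M)) * Real.exp L * Real.exp (-(p * ((1 - β) * n))) := by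
          rw [← hnL]
          gcongr
      _ = Real.exp (k * (1 + M) + L - p * ((1 - β) * n)) := by
          rw [← Real.exp_add, ← Real.exp_add, ← sub_eq_add_neg]
      _ ≤ Real.exp (3 * n * β * M - n * p / 2) := by
          apply Real.exp_le_exp.mpr
          have hk : k * (1 + M) ≤ (β * n + 1) * (1 + M) := by gcongr
          have hpβ : n * p * β ≤ n * p * (1 / 2) := by gcongr
          have hsmall : 3 * M * (2 * M - 1) ≤ β * n * (2 * M - 1) :=
            mul_le_mul_of_nonneg_right hβn (by linarith)
          nlinarith
  · have hexp : 12 * M ≤ Real.exp (0.4 * M) := by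
      nlinarith [Real.quadratic_le_exp_of_nonneg (show 0 ≤ 0.4 * M by linarith)]
    have hβp : 12 * (M * β) ≤ p :=
      calc 12 * (M * β) = 12 * M * β := by ring
        _ ≤ Real.exp (0.4 * M) * β := by gcongr
        _ = Real.exp (-0.6 * M) := by rw [hβ, ← Real.exp_add]; ring_nf
        _ ≤ p := hp₁
    nlinarith [mul_le_mul_of_nonneg_left hβp hn0.le]
  · have hfour : 4 * Real.exp (L * 0.9) ≤ n * p :=
      calc 4 * Real.exp (L * 0.9) ≤ Real.exp 3 * Real.exp (L * 0.9) := by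
            gcongr
            linarith [Real.add_one_le_exp 3]
        _ = Real.exp (3 + L * 0.9) := (Real.exp_add _ _).symm
        _ ≤ Real.exp (L + -0.6 * M) := Real.exp_le_exp.mpr (by nlinarith)
        _ = n * Real.exp (-0.6 * M) := by rw [Real.exp_add, hnL]
        _ ≤ n * p := by gcongr
    have hrpow : (n : ℝ) ^ (0.9 : ℝ) = Real.exp (L * 0.9) := by rw [hnL, ← Real.exp_mul]
    linarith
end

section
/- Fix the gap-instance parameters: n sufficiently large, m an integer with √(log n) ≤ m ≤ 2√(log n), h = ⌊m/8⌋, β = e^{−m}, and for each s ∈ {1,…,h}: p_s = β^{s−1}, n_s = ⌈(√n/2)·β^{−4s}⌉, k_s = ⌈β²·n_s⌉. Let v be a finitely supported nonnegative real vector all of whose nonzero entries equal p_s for a single fixed s ∈ {1,…,h}, with at most n_s nonzero entries. Then ψ(v) := Σ_{s'=1}^h Top_{k_{s'}}(v)/(k_{s'}·p_{s'}) satisfies ψ(v) ≤ 1 + h·β. In particular ψ(v) < 2 for n sufficiently large. -/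
open Finset
open scoped Classical

/-- `Topk k v` is the sum of the `k` largest entries of `v`: the maximum, over coordinate
subsets `S` with `|S| ≤ k` (this allows padding with zeros), of the sum of the entries of
`v` on `S`. -/
noncomputable def Topk {ι : Type*} [Fintype ι] (k : ℕ) (v : ι → ℝ) : ℝ :=
  ((Finset.univ : Finset ι).powerset.filter (fun S => S.card ≤ k)).sup'
    ⟨∅, by simp⟩ (fun S => ∑ j ∈ S, v j)

theorem Topk_le_mul {ι : Type*} [Fintype ι] (k : ℕ) {v : ι → ℝ} {a : ℝ} (ha : 0 ≤ a)
    (hv : ∀ j, v j ≤ a) : Topk k v ≤ k * a := by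
  refine Finset.sup'_le _ _ fun S hS => ?_
  have hcard : S.card ≤ k := (Finset.mem_filter.mp hS).2
  calc ∑ j ∈ S, v j ≤ S.card • a := Finset.sum_le_card_nsmul _ _ _ fun j _ => hv j
    _ = S.card * a := nsmul_eq_mul _ _
    _ ≤ k * a := by gcongr

theorem Topk_le_card_support_mul {ι : Type*} [Fintype ι] (k : ℕ) {v : ι → ℝ} {a : ℝ}
    (ha : 0 ≤ a) (hv : ∀ j, v j ≤ a) :
    Topk k v ≤ (Finset.univ.filter (fun j => v j ≠ 0)).card * a := by
  refine Finset.sup'_le _ _ fun S _ => ?_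
  calc ∑ j ∈ S, v j = ∑ j ∈ S.filter (fun j => v j ≠ 0), v j :=
        (Finset.sum_filter_ne_zero S).symm
    _ ≤ (S.filter (fun j => v j ≠ 0)).card • a :=
        Finset.sum_le_card_nsmul _ _ _ fun j _ => hv j
    _ = (S.filter (fun j => v j ≠ 0)).card * a := nsmul_eq_mul _ _
    _ ≤ (Finset.univ.filter (fun j => v j ≠ 0)).card * a := by
        gcongr
        exact Finset.subset_univ S

/-- Summing a term equal to `1` at `s`, at most `2 * b` at the successor of `s`, and at most `b`
elsewhere. -/
theorem sum_fin_le_one_add_mul {h : ℕ} (s : Fin h) {f : Fin h → ℝ} {b : ℝ} (hb : 0 ≤ b)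
    (hself : f s ≤ 1) (hsucc : ∀ t : Fin h, (t : ℕ) = s + 1 → f t ≤ 2 * b)
    (hother : ∀ t : Fin h, t ≠ s → (t : ℕ) ≠ s + 1 → f t ≤ b) :
    ∑ t, f t ≤ 1 + h * b := by
  have hterm : ∀ t : Fin h,
      f t ≤ b + (if t = s then 1 - b else 0) + (if (t : ℕ) = s + 1 then b else 0) := by
    intro t
    by_cases h1 : t = s
    · subst h1
      simpa using hself
    · by_cases h2 : (t : ℕ) = s + 1
      · simp only [h1, h2, if_true, if_false]
        linarith [hsucc t h2]
      · simp only [h1, h2, if_false]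
        linarith [hother t h1 h2]
  have hsum : ∑ t : Fin h, (if (t : ℕ) = s + 1 then b else 0) ≤ b := by
    rw [← Finset.sum_filter, Finset.sum_const, nsmul_eq_mul]
    have hcard : (Finset.univ.filter (fun t : Fin h => (t : ℕ) = s + 1)).card ≤ 1 := by
      refine Finset.card_le_one.mpr fun x hx y hy => Fin.ext ?_
      rw [(Finset.mem_filter.mp hx).2, (Finset.mem_filter.mp hy).2]
    exact mul_le_of_le_one_left hb (by exact_mod_cast hcard)
  calc ∑ t, f t
      ≤ ∑ t : Fin h, (b + (if t = s then 1 - b else 0) + (if (t : ℕ) = s + 1 then b else 0)) :=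
        Finset.sum_le_sum fun t _ => hterm t
    _ = h * b + (1 - b) + ∑ t : Fin h, (if (t : ℕ) = s + 1 then b else 0) := by
        simp [Finset.sum_add_distrib]
    _ ≤ 1 + h * b := by linarith

theorem geometric_class_bound {b x C : ℝ} (hb : 0 < b) (hx : 0 ≤ x) (s e : ℕ)
    (hC : 2 ≤ C * b⁻¹ ^ (3 * e + 1)) :
    2 * (x * b⁻¹ ^ (4 * (s + 1))) * b ^ s ≤
      C * (b ^ 2 * (x * b⁻¹ ^ (4 * (s + e + 1 + 1))) * b ^ (s + e + 1)) := by
  have hcancel : ∀ i : ℕ, b ^ i * b⁻¹ ^ i = 1 := fun i => by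
    rw [← mul_pow, mul_inv_cancel₀ hb.ne', one_pow]
  have hexp : 4 * (s + e + 1 + 1) = 4 * (s + 1) + (3 * e + 1) + (e + 3) := by ring
  calc 2 * (x * b⁻¹ ^ (4 * (s + 1))) * b ^ s = 2 * (x * b⁻¹ ^ (4 * (s + 1)) * b ^ s) := by ring
    _ ≤ C * b⁻¹ ^ (3 * e + 1) * (x * b⁻¹ ^ (4 * (s + 1)) * b ^ s) := by gcongr
    _ = C * b⁻¹ ^ (3 * e + 1) * (x * b⁻¹ ^ (4 * (s + 1)) * b ^ s) *
          (b ^ (e + 3) * b⁻¹ ^ (e + 3)) := by rw [hcancel, mul_one]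
    _ = C * (b ^ 2 * (x * b⁻¹ ^ (4 * (s + e + 1 + 1))) * b ^ (s + e + 1)) := by
        rw [hexp]
        ring

/-- with the gap-instance parameters (`n` large, `√(log n) ≤ m ≤ 2√(log n)`,
`h = ⌊m/8⌋`, `β = e^{-m}`, `p_s = β^{s-1}`, `n_s = ⌈(√n/2)·β^{-4s}⌉`, `k_s = ⌈β²·n_s⌉`,
where `s : Fin h` encodes the class `s+1 ∈ {1,…,h}`), any finitely supported nonnegative
vector `v` whose nonzero entries all equal `p_s` for one fixed class `s`, with at most
`n_s` nonzero entries, satisfies `ψ(v) = Σ_{s'} Top_{k_{s'}}(v)/(k_{s'}·p_{s'}) ≤ 1 + h·β`;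
in particular `ψ(v) < 2`. -/
theorem psi_on_single_size_class :
    ∃ N : ℕ, ∀ n : ℕ, N ≤ n → ∀ m : ℕ,
      Real.sqrt (Real.log n) ≤ (m : ℝ) → (m : ℝ) ≤ 2 * Real.sqrt (Real.log n) →
      ∀ β : ℝ, β = Real.exp (-(m : ℝ)) →
      ∀ p : Fin (m / 8) → ℝ, (∀ s, p s = β ^ (s : ℕ)) →
      ∀ ns : Fin (m / 8) → ℕ,
        (∀ s, ns s = ⌈(Real.sqrt n / 2) * β⁻¹ ^ (4 * ((s : ℕ) + 1))⌉₊) →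
      ∀ k : Fin (m / 8) → ℕ, (∀ s, k s = ⌈β ^ 2 * (ns s : ℝ)⌉₊) →
      ∀ (ι : Type) [Fintype ι] (v : ι → ℝ), (∀ j, 0 ≤ v j) →
      (∃ s : Fin (m / 8),
        (∀ j, v j ≠ 0 → v j = p s) ∧
        (Finset.univ.filter (fun j => v j ≠ 0)).card ≤ ns s) →
      (∑ s : Fin (m / 8), Topk (k s) v / ((k s : ℝ) * p s)) ≤
          1 + (m / 8 : ℕ) * β ∧
        (∑ s : Fin (m / 8), Topk (k s) v / ((k s : ℝ) * p s)) < 2 := by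
  refine ⟨4, fun n hn m _ _ β hβ p hp ns hns k hk ι _ v hv0 ⟨s, hvs, hcard⟩ => ?_⟩
  have hm : 8 ≤ m := by
    have := s.isLt
    omega
  have hβ0 : 0 < β := hβ ▸ Real.exp_pos _
  have hc : (m : ℝ) + 1 ≤ β⁻¹ := by
    rw [hβ, Real.exp_neg, inv_inv]
    exact Real.add_one_le_exp _
  have hm' : (8 : ℝ) ≤ m := by exact_mod_cast hm
  have hc2 : 2 ≤ β⁻¹ := by linarith
  have hβ1 : β ≤ 1 := (one_le_inv₀ hβ0).mp (by linarith)
  set x : ℝ := Real.sqrt n / 2 with hx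
  have hx1 : 1 ≤ x := by
    have : (2 : ℝ) ≤ Real.sqrt n := Real.le_sqrt_of_sq_le (by
      have : (4 : ℝ) ≤ n := by exact_mod_cast hn
      linarith)
    linarith
  have hp0 : ∀ t, 0 < p t := fun t => hp t ▸ pow_pos hβ0 _
  have hvle : ∀ j, v j ≤ p s := fun j => by
    by_cases h : v j = 0
    · exact h ▸ (hp0 s).le
    · exact (hvs j h).le
  have hns_ge : ∀ t : Fin (m / 8), x * β⁻¹ ^ (4 * ((t : ℕ) + 1)) ≤ ns t := fun t =>
    hns t ▸ Nat.le_ceil _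
  have hbase : ∀ t : Fin (m / 8), 1 ≤ x * β⁻¹ ^ (4 * ((t : ℕ) + 1)) := fun t =>
    one_le_mul_of_one_le_of_one_le hx1 (one_le_pow₀ (by linarith))
  have hns_le : ∀ t : Fin (m / 8), (ns t : ℝ) ≤ 2 * (x * β⁻¹ ^ (4 * ((t : ℕ) + 1))) := fun t => by
    have h1 := Nat.ceil_lt_add_one (zero_le_one.trans (hbase t))
    rw [← hns t] at h1
    linarith [hbase t]
  have hk_ge : ∀ t : Fin (m / 8), β ^ 2 * (x * β⁻¹ ^ (4 * ((t : ℕ) + 1))) ≤ k t := fun t =>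
    (mul_le_mul_of_nonneg_left (hns_ge t) (by positivity)).trans (hk t ▸ Nat.le_ceil _)
  have hk0 : ∀ t, (0 : ℝ) < k t := fun t =>
    (mul_pos (by positivity) (zero_lt_one.trans_le (hbase t))).trans_le (hk_ge t)
  have hlow : ∀ t (C : ℝ), p s ≤ C * p t → Topk (k t) v / ((k t : ℝ) * p t) ≤ C := by
    intro t C h
    rw [div_le_iff₀ (mul_pos (hk0 t) (hp0 t))]
    calc Topk (k t) v ≤ k t * p s := Topk_le_mul _ (hp0 s).le hvle
      _ ≤ k t * (C * p t) := by gcongr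
      _ = C * (k t * p t) := by ring
  have hhigh : ∀ (t : Fin (m / 8)) (e : ℕ) (C : ℝ), (t : ℕ) = s + e + 1 → 0 ≤ C →
      2 ≤ C * β⁻¹ ^ (3 * e + 1) → Topk (k t) v / ((k t : ℝ) * p t) ≤ C := by
    intro t e C ht hC0 hC
    rw [div_le_iff₀ (mul_pos (hk0 t) (hp0 t))]
    have hkt := hk_ge t
    rw [ht] at hkt
    calc Topk (k t) v ≤ (Finset.univ.filter (fun j => v j ≠ 0)).card * p s :=
          Topk_le_card_support_mul _ (hp0 s).le hvle
      _ ≤ ns s * p s := by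
          have := (hp0 s).le
          gcongr
      _ ≤ 2 * (x * β⁻¹ ^ (4 * ((s : ℕ) + 1))) * β ^ (s : ℕ) := by
          rw [hp s]
          gcongr
          exact hns_le s
      _ ≤ _ := geometric_class_bound hβ0 (by linarith) s e hC
      _ ≤ C * (k t * p t) := by
          rw [hp t, ht]
          gcongr
  have hle : (∑ t : Fin (m / 8), Topk (k t) v / ((k t : ℝ) * p t)) ≤ 1 + (m / 8 : ℕ) * β := by
    refine sum_fin_le_one_add_mul s hβ0.le (hlow s 1 (one_mul _).ge) (fun t ht => ?_)
      (fun t hts hts' => ?_)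
    · refine hhigh t 0 _ ht (by positivity) ?_
      rw [mul_zero, zero_add, pow_one, mul_assoc, mul_inv_cancel₀ hβ0.ne', mul_one]
    · rcases lt_or_gt_of_ne (Fin.val_ne_of_ne hts) with h | h
      · refine hlow t _ ?_
        rw [hp, hp, ← pow_succ']
        exact pow_le_pow_of_le_one hβ0.le hβ1 h
      · obtain ⟨e, he⟩ := Nat.exists_eq_add_of_le (show (s : ℕ) + 1 + 1 ≤ t by omega)
        refine hhigh t (e + 1) _ (by omega) hβ0.le ?_
        rw [pow_succ', ← mul_assoc, mul_inv_cancel₀ hβ0.ne', one_mul]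
        exact hc2.trans (le_self_pow₀ (by linarith) (by omega))
  refine ⟨hle, hle.trans_lt ?_⟩
  have hh : ((m / 8 : ℕ) : ℝ) < β⁻¹ := by
    have : ((m / 8 : ℕ) : ℝ) ≤ m := by exact_mod_cast Nat.div_le_self m 8
    linarith
  have := (lt_inv_mul_iff₀ hβ0).mp (by simpa using hh : ((m / 8 : ℕ) : ℝ) < β⁻¹ * 1)
  linarith [mul_comm β ((m / 8 : ℕ) : ℝ)]
end

section
/- Let m, h, ℓ be positive integers and β ∈ (0,1) with m·β < 1. For each s ∈ {1,…,h}, let (U(s); A_1(s), …, A_m(s)) be an (n_s, m, ℓ, β) set-system, where the universes U(1), …, U(h) are pairwise disjoint. Let ρ be any function assigning each element of ⋃_s U(s) to an index in {1,…,m}, such that an element u ∈ U(s) may be assigned to i only if u ∈ A_i(s). Then there exists an index i ∈ {1,…,m} such that for at least h·ℓ/m values of s ∈ {1,…,h}, at least β²·n_s elements of A_i(s) are assigned to i by ρ. -/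
open Finset
open scoped Classical

/-- In a set-system with `m * β < 1`, every assignment of elements to sets containing them has
at least `ℓ` classes of size at least `β ^ 2 * n`. -/
theorem IsSetSystem.le_card_heavy {n m ℓ : ℕ} {β : ℝ} {A : Fin m → Finset (Fin n)}
    (hA : IsSetSystem n m ℓ β A) (hβ : 0 < β) (hmβ : (m : ℝ) * β < 1) (hn : 0 < n)
    (ρ : Fin n → Fin m) (hρ : ∀ u, u ∈ A (ρ u)) :
    ℓ ≤ (univ.filter fun i : Fin m =>
      β ^ 2 * (n : ℝ) ≤ ((univ.filter fun u => ρ u = i).card : ℝ)).card := by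
  by_contra! hlt
  set H := univ.filter fun i : Fin m =>
    β ^ 2 * (n : ℝ) ≤ ((univ.filter fun u => ρ u = i).card : ℝ) with hH
  have hcover := hA H hlt.le A fun _ _ => Or.inl rfl
  have hsub : (univ : Finset (Fin n)) ⊆
      H.biUnion A ∪ Hᶜ.biUnion fun i => univ.filter fun u => ρ u = i := by
    intro u _
    by_cases hu : ρ u ∈ H
    · exact mem_union_left _ (mem_biUnion.2 ⟨ρ u, hu, hρ u⟩)
    · exact mem_union_right _ (mem_biUnion.2 ⟨ρ u, mem_compl.2 hu, by simp⟩)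
  have hcard : (n : ℝ) ≤ (H.biUnion A).card +
      ∑ i ∈ Hᶜ, ((univ.filter fun u => ρ u = i).card : ℝ) := by
    have h := (card_le_card hsub).trans
      ((card_union_le _ _).trans (Nat.add_le_add_left card_biUnion_le _))
    rw [card_univ, Fintype.card_fin] at h
    exact_mod_cast h
  have hlight : ∑ i ∈ Hᶜ, ((univ.filter fun u => ρ u = i).card : ℝ) ≤ m * (β ^ 2 * n) := by
    have hsum : ∑ i ∈ Hᶜ, ((univ.filter fun u => ρ u = i).card : ℝ) ≤
        Hᶜ.card • (β ^ 2 * (n : ℝ)) := by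
      refine sum_le_card_nsmul _ _ _ fun i hi => ?_
      simp only [hH, mem_compl, mem_filter, mem_univ, true_and, not_le] at hi
      exact hi.le
    rw [nsmul_eq_mul] at hsum
    have hle : (Hᶜ.card : ℝ) ≤ m := by
      exact_mod_cast (card_le_univ Hᶜ).trans_eq (Fintype.card_fin m)
    exact hsum.trans (mul_le_mul_of_nonneg_right hle (by positivity))
  have hpos : 0 < β * (n : ℝ) := mul_pos hβ (by exact_mod_cast hn)
  nlinarith [mul_lt_mul_of_pos_right hmβ hpos]

/-- given `h` disjoint `(n_s, m, ℓ, β)` set-systems (with `m·β < 1`), and any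
assignment `ρ` sending each element `u ∈ U(s)` to an index `i` with `u ∈ A_i(s)`, there is
an index `i` such that for at least `h·ℓ/m` values of `s`, at least `β²·n_s` elements of
`A_i(s)` are assigned to `i`.  Disjointness of the universes is expressed by using a
separate type `Fin (ns s)` for each universe. -/
theorem exists_machine_many_heavy_classes
    (m h ℓ : ℕ) (hm : 0 < m) (hh : 0 < h) (hℓ : 0 < ℓ)
    (β : ℝ) (hβ : 0 < β) (hβ1 : β < 1) (hmβ : (m : ℝ) * β < 1)
    (ns : Fin h → ℕ) (hns : ∀ s, 0 < ns s)
    (A : (s : Fin h) → Fin m → Finset (Fin (ns s)))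
    (hA : ∀ s, IsSetSystem (ns s) m ℓ β (A s))
    (ρ : (s : Fin h) → Fin (ns s) → Fin m)
    (hρ : ∀ s u, u ∈ A s (ρ s u)) :
    ∃ i : Fin m,
      (h : ℝ) * ℓ / m ≤
        ((Finset.univ.filter (fun s : Fin h =>
            β ^ 2 * (ns s : ℝ) ≤
              ((Finset.univ.filter (fun u : Fin (ns s) => ρ s u = i)).card : ℝ))).card : ℝ) := by
  by_contra! hlt
  have hcount : ∑ i : Fin m, (univ.filter fun s : Fin h => β ^ 2 * (ns s : ℝ) ≤
        ((univ.filter fun u : Fin (ns s) => ρ s u = i).card : ℝ)).card =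
      ∑ s : Fin h, (univ.filter fun i : Fin m => β ^ 2 * (ns s : ℝ) ≤
        ((univ.filter fun u : Fin (ns s) => ρ s u = i).card : ℝ)).card := by
    simp only [card_filter _ (univ : Finset (Fin m)), card_filter _ (univ : Finset (Fin h))]
    exact sum_comm
  have hlower := card_nsmul_le_sum univ _ ℓ fun s (_ : s ∈ (univ : Finset (Fin h))) =>
    (hA s).le_card_heavy hβ hmβ (hns s) (ρ s) (hρ s)
  rw [← hcount, card_univ, Fintype.card_fin, smul_eq_mul] at hlower
  have hupper := sum_lt_sum_of_nonempty (s := (univ : Finset (Fin m)))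
    ⟨⟨0, hm⟩, mem_univ _⟩ fun i _ => hlt i
  have hm' : (m : ℝ) ≠ 0 := by exact_mod_cast hm.ne'
  rw [sum_const, card_univ, Fintype.card_fin, nsmul_eq_mul, mul_div_cancel₀ _ hm'] at hupper
  exact absurd hlower (not_le.2 (by exact_mod_cast hupper))
end

section
/- Let (U; A_1, …, A_m) be an (n, m, ℓ, β) set-system, let π : {1,…,m} → {1,…,m} be a function, and let L₁, L₂ ⊆ {1,…,m} with |L₁| + |L₂| ≤ ℓ. Let d ≥ 1 be a real number with 2m·β·d < 1. Suppose there are sets C_a ⊆ A_{π(a)} for each a ∉ L₁ and D_b ⊆ U \ A_b for each b ∉ L₂, each of size at most β²·n·d, such that U = (⋃_{a∈L₁} A_{π(a)}) ∪ (⋃_{b∈L₂} (U \ A_b)) ∪ (⋃_{a∉L₁} C_a) ∪ (⋃_{b∉L₂} D_b). Then there exist a ∈ L₁ and b ∈ L₂ with π(a) = b. -/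
open Finset
open scoped Classical

/-- in an `(n, m, ℓ, β)` set-system, given `π : [m] → [m]`,
`L₁, L₂ ⊆ [m]` with `|L₁| + |L₂| ≤ ℓ`, `d ≥ 1` with `2mβd < 1`, and small sets
`C_a ⊆ A_{π(a)}` (`a ∉ L₁`) and `D_b ⊆ U \ A_b` (`b ∉ L₂`), each of size at most `β²nd`,
if `U` equals the union `(⋃_{a∈L₁} A_{π(a)}) ∪ (⋃_{b∈L₂} U \ A_b) ∪ (⋃_{a∉L₁} C_a) ∪
(⋃_{b∉L₂} D_b)`, then some `a ∈ L₁` and `b ∈ L₂` satisfy `π(a) = b`. -/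
theorem cover_gives_matching_labels
    (n m ℓ : ℕ) (hn : 0 < n) (hm : 0 < m)
    (β : ℝ) (hβ : 0 < β) (hβ1 : β < 1)
    (A : Fin m → Finset (Fin n)) (hA : IsSetSystem n m ℓ β A)
    (π : Fin m → Fin m) (L₁ L₂ : Finset (Fin m)) (hL : L₁.card + L₂.card ≤ ℓ)
    (d : ℝ) (hd : 1 ≤ d) (hsmall : 2 * (m : ℝ) * β * d < 1)
    (C D : Fin m → Finset (Fin n))
    (hC : ∀ a ∉ L₁, C a ⊆ A (π a) ∧ ((C a).card : ℝ) ≤ β ^ 2 * n * d)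
    (hD : ∀ b ∉ L₂, D b ⊆ (A b)ᶜ ∧ ((D b).card : ℝ) ≤ β ^ 2 * n * d)
    (hcover : (Finset.univ : Finset (Fin n)) =
      (L₁.biUnion (fun a => A (π a))) ∪ (L₂.biUnion (fun b => (A b)ᶜ)) ∪
        (L₁ᶜ.biUnion C) ∪ (L₂ᶜ.biUnion D)) :
    ∃ a ∈ L₁, ∃ b ∈ L₂, π a = b := by
  by_contra! hne
  have card_biUnion_compl_le : ∀ (L : Finset (Fin m)) (E : Fin m → Finset (Fin n)),
      (∀ a ∉ L, ((E a).card : ℝ) ≤ β ^ 2 * n * d) →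
        ((Lᶜ.biUnion E).card : ℝ) ≤ m * (β ^ 2 * n * d) := by
    intro L E hE
    calc ((Lᶜ.biUnion E).card : ℝ) ≤ ∑ a ∈ Lᶜ, ((E a).card : ℝ) := by
          exact_mod_cast card_biUnion_le
      _ ≤ Lᶜ.card • (β ^ 2 * n * d) :=
          sum_le_card_nsmul _ _ _ fun a ha => hE a (mem_compl.mp ha)
      _ ≤ m * (β ^ 2 * n * d) := by
          rw [nsmul_eq_mul]
          have hcard : (Lᶜ.card : ℝ) ≤ m := by
            exact_mod_cast (card_le_univ Lᶜ).trans_eq (Fintype.card_fin m)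
          gcongr
  have hC' := card_biUnion_compl_le L₁ C fun a ha => (hC a ha).2
  have hD' := card_biUnion_compl_le L₂ D fun b hb => (hD b hb).2
  have hlarge := hA (L₁.image π ∪ L₂)
    ((card_union_le _ _).trans ((Nat.add_le_add_right card_image_le _).trans hL))
    (fun i => if i ∈ L₂ then (A i)ᶜ else A i)
    (fun i _ => by by_cases hi : i ∈ L₂ <;> simp [hi])
  set V := (L₁.image π ∪ L₂).biUnion (fun i => if i ∈ L₂ then (A i)ᶜ else A i)
  have hsub : (univ : Finset (Fin n)) ⊆ V ∪ L₁ᶜ.biUnion C ∪ L₂ᶜ.biUnion D := by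
    rw [hcover]
    refine union_subset_union (union_subset_union (union_subset ?_ ?_) subset_rfl) subset_rfl
    · intro x hx
      obtain ⟨a, ha, hxa⟩ := mem_biUnion.mp hx
      have hπ : π a ∉ L₂ := fun h => hne a ha _ h rfl
      exact mem_biUnion.mpr
        ⟨π a, mem_union_left _ (mem_image_of_mem π ha), by rwa [if_neg hπ]⟩
    · intro x hx
      obtain ⟨b, hb, hxb⟩ := mem_biUnion.mp hx
      exact mem_biUnion.mpr ⟨b, mem_union_right _ hb, by rwa [if_pos hb]⟩
  have hcard : (n : ℝ) ≤ V.card + (L₁ᶜ.biUnion C).card + (L₂ᶜ.biUnion D).card := by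
    have h := (card_le_card hsub).trans
      ((card_union_le _ _).trans (Nat.add_le_add_right (card_union_le _ _) _))
    rw [card_univ, Fintype.card_fin] at h
    exact_mod_cast h
  have hβn : 0 < β * n := by positivity
  nlinarith [mul_lt_mul_of_pos_left hsmall hβn]
end
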